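/- arXiv:0904.0848 — 6 statements merged into one kernel-verified Lean document; each statement's English description precedes it below -/
import Mathlib

section
/- Let K be a compact metrizable abelian group and Γ a group of continuous automorphisms of K. Suppose Δ is a normal subgroup of Γ which is compact in the group of continuous automorphisms of K equipped with the compact-open topology, Γ/Δ is abelian, and Γ is generated by Δ together with elements α₁, …, α_n ∈ Γ. Then the action of Γ on K is distal if and only if each α_i is distal on K for i = 1, …, n. -/
open MeasureTheory Topology Set

set_option linter.unusedVariables false

namespace ErgZd

variable {K : Type*}

/-- The group of bi-continuous automorphisms of a topological group,
as a subgroup of `MulAut K`. -/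
def ContAut (K : Type*) [Group K] [TopologicalSpace K] : Subgroup (MulAut K) where
  carrier := {α | Continuous α ∧ Continuous α.symm}
  one_mem' := ⟨continuous_id, continuous_id⟩
  mul_mem' := fun {a b} ha hb => ⟨ha.1.comp hb.1, hb.2.comp ha.2⟩
  inv_mem' := fun {a} ha => ⟨ha.2, ha.1⟩

section Defs

variable [Group K] [TopologicalSpace K]

lemma ContAut.continuous (α : ↥(ContAut K)) : Continuous ⇑(α : MulAut K) := α.2.1

lemma ContAut.continuous_symm (α : ↥(ContAut K)) :
    Continuous ⇑(α : MulAut K).symm := α.2.2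

/-- Ergodicity of the action of a set `S` of automorphisms with respect to `μ`:
every invariant Borel set is null or conull. -/
def ErgSet [MeasurableSpace K] (μ : Measure K) (S : Set ↥(ContAut K)) : Prop :=
  ∀ A : Set K, MeasurableSet A → (∀ α ∈ S, (α : MulAut K) '' A = A) → μ A = 0 ∨ μ A = 1

/-- Ergodicity of a single automorphism: ergodicity of the group of its integer powers. -/
def ErgAut [MeasurableSpace K] (μ : Measure K) (α : ↥(ContAut K)) : Prop :=
  ErgSet μ (Set.range fun n : ℤ => α ^ n)

/-- Distality of the action of a set of automorphisms: for `x ≠ 1`, the identity is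
not in the closure of the orbit of `x`. -/
def DistalSet (S : Set ↥(ContAut K)) : Prop :=
  ∀ x : K, x ≠ 1 → (1 : K) ∉ closure ((fun α : ↥(ContAut K) => (α : MulAut K) x) '' S)

/-- Distality of a single automorphism. -/
def DistalAut (α : ↥(ContAut K)) : Prop := DistalSet (Set.range fun n : ℤ => α ^ n)

/-- The descending chain condition for an action: every decreasing
sequence of closed invariant subgroups is eventually constant. -/
def HasDCC (S : Set ↥(ContAut K)) : Prop :=
  ∀ C : ℕ → Subgroup K, (∀ n, IsClosed (C n : Set K)) → (∀ n, C (n + 1) ≤ C n) →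
    (∀ n, ∀ α ∈ S, ∀ x, x ∈ C n ↔ (α : MulAut K) x ∈ C n) → ∃ N, ∀ n, N ≤ n → C n = C N

/-- Restriction of an automorphism to an invariant subgroup. -/
def restrictAut (H : Subgroup K) (α : ↥(ContAut K))
    (h : ∀ x, x ∈ H ↔ (α : MulAut K) x ∈ H) : ↥(ContAut ↥H) := by
  refine ⟨⟨⟨fun x => ⟨(α : MulAut K) x, (h x).mp x.2⟩,
      fun x => ⟨(α : MulAut K).symm x, (h _).mpr (by simpa using x.2)⟩, ?_, ?_⟩, ?_⟩, ?_, ?_⟩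
  · intro x; ext; simp
  · intro x; ext; simp
  · intro x y; ext; simp
  · exact Continuous.subtype_mk ((ContAut.continuous α).comp continuous_subtype_val) _
  · exact Continuous.subtype_mk ((ContAut.continuous_symm α).comp continuous_subtype_val) _

@[simp] lemma restrictAut_coe (H : Subgroup K) (α : ↥(ContAut K))
    (h : ∀ x, x ∈ H ↔ (α : MulAut K) x ∈ H) (x : ↥H) :
    ((((restrictAut H α h) : MulAut ↥H) x : ↥H) : K) = (α : MulAut K) (x : K) := rfl

/-- The automorphism induced on the quotient by an invariant closed normal subgroup. -/
def quotAut (N : Subgroup K) [N.Normal] (α : ↥(ContAut K))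
    (h : ∀ x, x ∈ N ↔ (α : MulAut K) x ∈ N) : ↥(ContAut (K ⧸ N)) := by
  have hmap : N.map ((α : MulAut K) : K ≃* K) = N := by
    ext y
    constructor
    · rintro ⟨x, hx, rfl⟩; exact (h x).mp hx
    · intro hy
      exact ⟨(α : MulAut K).symm y, (h _).mpr (by simpa using hy), by simp⟩
  refine ⟨QuotientGroup.congr N N ((α : MulAut K) : K ≃* K) hmap, ?_, ?_⟩
  · apply (QuotientGroup.isQuotientMap_mk N).continuous_iff.mpr
    have : ⇑(QuotientGroup.congr N N ((α : MulAut K) : K ≃* K) hmap) ∘ (QuotientGroup.mk : K → K ⧸ N)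
        = (QuotientGroup.mk : K → K ⧸ N) ∘ ⇑(α : MulAut K) := by
      funext x
      exact QuotientGroup.congr_mk N N _ hmap x
    rw [this]
    exact QuotientGroup.continuous_mk.comp (ContAut.continuous α)
  · apply (QuotientGroup.isQuotientMap_mk N).continuous_iff.mpr
    have : ⇑(QuotientGroup.congr N N ((α : MulAut K) : K ≃* K) hmap).symm ∘ (QuotientGroup.mk : K → K ⧸ N)
        = (QuotientGroup.mk : K → K ⧸ N) ∘ ⇑((α : MulAut K) : K ≃* K).symm := by
      funext x
      rfl
    rw [this]
    exact QuotientGroup.continuous_mk.comp (ContAut.continuous_symm α)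

end Defs

set_option linter.unusedSectionVars false

lemma exists_algHom_ne_zero {B : Type*} [CStarAlgebra B] {S : Set B}
    (hcomm : ∀ a ∈ S, ∀ b ∈ S, a * b = b * a) (hstar : ∀ a ∈ S, star a ∈ S)
    (b : StarAlgebra.adjoin ℂ S) (hb : b ≠ 0) :
    ∃ φ : StarAlgebra.adjoin ℂ S →ₐ[ℂ] ℂ, (∀ a, ‖φ a‖ ≤ ‖a‖) ∧ φ b ≠ 0 := by
  have hc := StarAlgebra.isMulCommutative_adjoin ℂ hcomm
    fun a ha b hb => hcomm a ha _ (hstar b hb)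
  set C := (StarAlgebra.adjoin ℂ S).topologicalClosure with hC
  have hcl : IsClosed (C : Set B) := StarSubalgebra.isClosed_topologicalClosure _
  let _ : CommRing C := StarSubalgebra.commRingTopologicalClosure _ fun x y => hc.is_comm.comm x y
  let _ : CStarAlgebra C := StarSubalgebra.cstarAlgebra C (h_closed := hcl)
  let _ : CommCStarAlgebra C := {  mul_comm := mul_comm }
  let ι : StarAlgebra.adjoin ℂ S →⋆ₐ[ℂ] C :=
    StarSubalgebra.inclusion (StarSubalgebra.le_topologicalClosure _)
  have hιb : ι b ≠ 0 := fun h => hb (Subtype.ext (by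
    simpa [ι] using congrArg (Subtype.val : C → B) h))
  have : Nontrivial C := ⟨_, _, hιb⟩
  have hne : WeakDual.gelfandTransform ℂ C (ι b) ≠ 0 := fun h =>
    hιb ((gelfandTransform_isometry C).injective (by rw [h, map_zero]))
  obtain ⟨φ, hφ⟩ := DFunLike.ne_iff.mp hne
  refine ⟨(WeakDual.CharacterSpace.toAlgHom φ).comp ι.toAlgHom, fun a => ?_, hφ⟩
  exact AlgHom.norm_apply_le_self (WeakDual.CharacterSpace.toAlgHom φ) (ι a)

section
variable {K : Type*} [CommGroup K] [TopologicalSpace K] [IsTopologicalGroup K] [CompactSpace K]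
  [T2Space K] [SecondCountableTopology K] [MeasurableSpace K] [BorelSpace K]
  (μ : Measure K) [μ.IsHaarMeasure]

/-- Translation by `y` on `L²`. -/
noncomputable def translationL2 (y : K) : Lp ℂ 2 μ →ₗᵢ[ℂ] Lp ℂ 2 μ :=
  Lp.compMeasurePreservingₗᵢ ℂ (fun x => y * x) (measurePreserving_mul_left μ y)

lemma translationL2_toLp (y : K) (f : C(K, ℂ)) :
    translationL2 μ y (f.toLp 2 μ ℂ) = (f.comp (ContinuousMap.mulLeft y)).toLp 2 μ ℂ := rfl

lemma translationL2_mul (y z : K) (g : Lp ℂ 2 μ) :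
    translationL2 μ (y * z) g = translationL2 μ y (translationL2 μ z g) := by
  rw [mul_comm]
  exact mul_smul (DomMulAct.mk y) (DomMulAct.mk z) g

lemma translationL2_one (g : Lp ℂ 2 μ) : translationL2 μ 1 g = g :=
  one_smul (Kᵈᵐᵃ) g

lemma continuous_translationL2 (g : Lp ℂ 2 μ) : Continuous fun y => translationL2 μ y g := by
  have : Continuous fun y : K => DomMulAct.mk y • g := by
    have : Fact ((2 : ENNReal) ≠ ⊤) := ⟨by simp⟩
    have h : Continuous fun c : Kᵈᵐᵃ => c • g := continuous_id.smul continuous_const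
    exact h.comp DomMulAct.continuous_mk
  exact this

lemma integrable_smul_translationL2 (f : C(K, ℂ)) (g : Lp ℂ 2 μ) :
    Integrable (fun y => f y • translationL2 μ y g) μ :=
  (f.continuous.smul (continuous_translationL2 μ g)).integrable_of_hasCompactSupport
    (HasCompactSupport.of_compactSpace _)

/-- The operator `∫ f y • U y` on `L²`, where `U` denotes the action by translations. -/
noncomputable def averageL2 : C(K, ℂ) →L[ℂ] (Lp ℂ 2 μ →L[ℂ] Lp ℂ 2 μ) :=
  LinearMap.mkContinuous₂
    (LinearMap.mk₂ ℂ (fun (f : C(K, ℂ)) g => ∫ y, f y • translationL2 μ y g ∂μ)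
      (fun f₁ f₂ g => by
        simp_rw [ContinuousMap.add_apply, add_smul]
        exact integral_add (integrable_smul_translationL2 μ f₁ g)
          (integrable_smul_translationL2 μ f₂ g))
      (fun c f g => by
        simp_rw [ContinuousMap.smul_apply, smul_assoc]
        exact integral_smul _ _)
      (fun f g₁ g₂ => by
        simp_rw [map_add, smul_add]
        exact integral_add (integrable_smul_translationL2 μ f g₁)
          (integrable_smul_translationL2 μ f g₂))
      (fun c f g => by
        simp_rw [map_smul, smul_comm _ c]
        exact integral_smul _ _))
    (μ.real univ) (fun f g => by
      rw [mul_assoc, mul_comm]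
      refine norm_integral_le_of_norm_le_const (Filter.Eventually.of_forall fun y => ?_)
      rw [norm_smul, LinearIsometry.norm_map]
      gcongr
      exact f.norm_coe_le_norm y)

lemma averageL2_apply (f : C(K, ℂ)) (g : Lp ℂ 2 μ) :
    averageL2 μ f g = ∫ y, f y • translationL2 μ y g ∂μ := rfl

lemma averageL2_injective : Function.Injective (averageL2 μ) := by
  refine (injective_iff_map_eq_zero _).2 fun k hk => ?_
  let τ : C(K, C(K, ℂ)) :=
    ContinuousMap.curry ⟨fun p : K × K => (starRingEnd ℂ) (k (p.1 * p.2)), by fun_prop⟩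
  have hint : Integrable (fun y => k y • τ y) μ :=
    (k.continuous.smul τ.continuous).integrable_of_hasCompactSupport
      (HasCompactSupport.of_compactSpace _)
  have h0 : (∫ y, k y • τ y ∂μ).toLp 2 μ ℂ = (0 : C(K, ℂ)).toLp 2 μ ℂ := by
    rw [map_zero, ← ContinuousLinearMap.integral_comp_comm _ hint]
    have := congrArg (fun T => T ((τ 1).toLp 2 μ ℂ)) hk
    simp only [averageL2_apply, translationL2_toLp] at this
    refine Eq.trans ?_ this
    congr 1 with y
    rw [map_smul]
    have : τ y = (τ 1).comp (ContinuousMap.mulLeft y) := by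
      ext x
      simp [τ]
    rw [this]
  have h1 := congrArg (ContinuousMap.evalCLM ℂ (1 : K)) (ContinuousMap.toLp_injective μ h0)
  rw [← ContinuousLinearMap.integral_comp_comm _ hint] at h1
  have h2 : ∫ y, ‖k y‖ ^ 2 ∂μ = 0 := by
    rw [← Complex.ofReal_inj, ← integral_complex_ofReal]
    simpa [τ, Complex.mul_conj'] using h1
  have hc : Continuous fun y => ‖k y‖ ^ 2 := by fun_prop
  rw [integral_eq_zero_iff_of_nonneg (fun y => by positivity)
    (hc.integrable_of_hasCompactSupport (HasCompactSupport.of_compactSpace _)),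
    hc.ae_eq_iff_eq μ continuous_zero] at h2
  ext y
  simpa using congrFun h2 y

lemma translationL2_averageL2 (x : K) (f : C(K, ℂ)) (g : Lp ℂ 2 μ) :
    translationL2 μ x (averageL2 μ f g) =
      averageL2 μ (f.comp (ContinuousMap.mulLeft x⁻¹)) g := by
  have h := ContinuousLinearMap.integral_comp_comm
    (translationL2 μ x).toContinuousLinearMap (integrable_smul_translationL2 μ f g)
  rw [averageL2_apply, averageL2_apply]
  refine h.symm.trans ?_
  rw [← integral_mul_left_eq_self (fun y => (f.comp (ContinuousMap.mulLeft x⁻¹)) y • _) x]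
  congr 1
  ext1 y
  simp [translationL2_mul]

lemma averageL2_commute {f : C(K, ℂ)} {T : Lp ℂ 2 μ →L[ℂ] Lp ℂ 2 μ}
    (hT : ∀ y g, T (translationL2 μ y g) = translationL2 μ y (T g)) :
    averageL2 μ f * T = T * averageL2 μ f := by
  ext1 g
  have h := ContinuousLinearMap.integral_comp_comm T (integrable_smul_translationL2 μ f g)
  simp only [mul_apply_eq_comp, averageL2_apply, ← h]
  simp [hT]

lemma star_translationL2 (y : K) :
    star (translationL2 μ y).toContinuousLinearMap =
      (translationL2 μ y⁻¹).toContinuousLinearMap := by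
  rw [ContinuousLinearMap.star_eq_adjoint, eq_comm, ContinuousLinearMap.eq_adjoint_iff]
  intro g h
  have := (translationL2 μ y⁻¹).inner_map_map g (translationL2 μ y h)
  rw [← translationL2_mul, inv_mul_cancel, translationL2_one] at this
  exact this
lemma star_averageL2 (f : C(K, ℂ)) :
    star (averageL2 μ f) =
      averageL2 μ ⟨fun y => (starRingEnd ℂ) (f y⁻¹), by fun_prop⟩ := by
  rw [ContinuousLinearMap.star_eq_adjoint, eq_comm, ContinuousLinearMap.eq_adjoint_iff]
  intro g h
  have hadj : ∀ y, inner ℂ (translationL2 μ y⁻¹ g) h = inner ℂ g (translationL2 μ y h) := by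
    intro y
    have := (translationL2 μ y).inner_map_map (translationL2 μ y⁻¹ g) h
    rw [← translationL2_mul, mul_inv_cancel, translationL2_one] at this
    exact this.symm
  rw [averageL2_apply, averageL2_apply, ← integral_inner (integrable_smul_translationL2 μ f h),
    ← inner_conj_symm, ← integral_inner (integrable_smul_translationL2 μ _ g), ← integral_conj,
    ← integral_inv_eq_self]
  congr 1 with y
  rw [inner_conj_symm, inner_smul_left, inner_smul_right, hadj]
  simp

end

/-- The continuous characters of a compact abelian group separate its points. -/
lemma exists_pontryaginDual_ne_one {K : Type*} [CommGroup K] [TopologicalSpace K]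
    [IsTopologicalGroup K] [CompactSpace K] [TopologicalSpace.MetrizableSpace K]
    {x : K} (hx : x ≠ 1) : ∃ χ : PontryaginDual K, χ x ≠ 1 := by
  let _ : MeasurableSpace K := borel K
  have : BorelSpace K := ⟨rfl⟩
  have : SecondCountableTopology K := by
    let _ := TopologicalSpace.metrizableSpaceMetric K
    infer_instance
  let μ : Measure K := Measure.haar
  let U : K → (Lp ℂ 2 μ →L[ℂ] Lp ℂ 2 μ) := fun y => (translationL2 μ y).toContinuousLinearMap
  have hUmul : ∀ y z, U (y * z) = U y * U z := fun y z => by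
    ext1 g; exact translationL2_mul μ y z g
  have hUone : U 1 = 1 := by ext1 g; exact translationL2_one μ g
  have hUnorm : ∀ y, ‖U y‖ ≤ 1 := fun y => (translationL2 μ y).norm_toContinuousLinearMap_le
  have hUcomm : ∀ y g z, translationL2 μ y (translationL2 μ z g) =
      translationL2 μ z (translationL2 μ y g) := fun y g z => by
    rw [← translationL2_mul, ← translationL2_mul, mul_comm]
  have hTU : ∀ f y, averageL2 μ f * U y = U y * averageL2 μ f := fun f y =>
    averageL2_commute μ fun z g => hUcomm y g z
  let S : Set (Lp ℂ 2 μ →L[ℂ] Lp ℂ 2 μ) := range U ∪ range (averageL2 μ)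
  have hcomm : ∀ a ∈ S, ∀ b ∈ S, a * b = b * a := by
    rintro _ (⟨y, rfl⟩ | ⟨f, rfl⟩) _ (⟨z, rfl⟩ | ⟨k, rfl⟩)
    · rw [← hUmul, ← hUmul, mul_comm]
    · exact (hTU _ _).symm
    · exact hTU _ _
    · exact averageL2_commute μ fun y g => DFunLike.congr_fun (hTU k y) g
  have hstar : ∀ a ∈ S, star a ∈ S := by
    rintro _ (⟨y, rfl⟩ | ⟨f, rfl⟩)
    · exact Or.inl ⟨y⁻¹, (star_translationL2 μ y).symm⟩
    · exact Or.inr ⟨_, (star_averageL2 μ f).symm⟩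
  obtain ⟨f, hfx⟩ : ∃ f : C(K, ℂ), f x⁻¹ ≠ f 1 := by
    let _ := TopologicalSpace.metrizableSpaceMetric K
    exact ⟨⟨fun y => (dist y 1 : ℂ), by fun_prop⟩, by simpa using hx⟩
  let u : K → StarAlgebra.adjoin ℂ S := fun y =>
    ⟨U y, StarAlgebra.subset_adjoin ℂ S (Or.inl ⟨y, rfl⟩)⟩
  let t : StarAlgebra.adjoin ℂ S :=
    ⟨averageL2 μ f, StarAlgebra.subset_adjoin ℂ S (Or.inr ⟨f, rfl⟩)⟩
  have hUT : ∀ y, U y * averageL2 μ f = averageL2 μ (f.comp (ContinuousMap.mulLeft y⁻¹)) :=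
    fun y => by ext1 g; exact translationL2_averageL2 μ y f g
  have hb : (u x - 1) * t ≠ 0 := by
    intro h
    have h' : U x * averageL2 μ f = averageL2 μ f := by
      simpa [u, t, sub_mul, sub_eq_zero] using congrArg Subtype.val h
    rw [hUT] at h'
    have := DFunLike.congr_fun (averageL2_injective μ h') 1
    exact hfx (by simpa using this)
  obtain ⟨φ, hφ, hφb⟩ := exists_algHom_ne_zero hcomm hstar _ hb
  rw [map_mul, map_sub, map_one] at hφb
  have hφu : φ (u x) ≠ 1 := fun h => hφb (by rw [h, sub_self, zero_mul])
  have hφt : φ t ≠ 0 := fun h => hφb (by rw [h, mul_zero])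
  have humul : ∀ y z, φ (u (y * z)) = φ (u y) * φ (u z) := fun y z => by
    rw [← map_mul]
    exact congrArg φ (Subtype.ext (hUmul y z))
  have huone : φ (u 1) = 1 := by
    rw [← map_one φ]
    exact congrArg φ (Subtype.ext hUone)
  have hle : ∀ y, ‖φ (u y)‖ ≤ 1 := fun y => (hφ _).trans (hUnorm y)
  have hnorm : ∀ y, ‖φ (u y)‖ = 1 := fun y => by
    refine le_antisymm (hle y) ?_
    have h := congrArg norm (humul y y⁻¹)
    rw [mul_inv_cancel, huone, norm_one, norm_mul] at h
    have := hle y⁻¹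
    nlinarith [norm_nonneg (φ (u y))]
  have hcont : Continuous fun y => φ (u y) := by
    have h1 : Continuous fun y => u y * t := by
      refine continuous_induced_rng.2 ?_
      have h2 : Continuous fun y : K => f.comp (ContinuousMap.mulLeft y⁻¹) :=
        ContinuousMap.continuous_of_continuous_uncurry _ (by
          simp only [Function.uncurry_def, ContinuousMap.comp_apply, ContinuousMap.coe_mulLeft]
          fun_prop)
      refine ((averageL2 μ).continuous.comp h2).congr fun y => (hUT y).symm
    have h3 : Continuous φ :=
      AddMonoidHomClass.continuous_of_bound φ 1 fun a => by simpa using hφ a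
    refine ((h3.comp h1).div_const (φ t)).congr fun y => ?_
    simp [hφt]
  have hmem : ∀ y, φ (u y) ∈ Submonoid.unitSphere ℂ := fun y => by
    simpa [Submonoid.unitSphere] using hnorm y
  let χ : K →ₜ* Circle :=
    { toFun := fun y => ⟨φ (u y), hmem y⟩
      map_one' := Circle.ext huone
      map_mul' := fun y z => Circle.ext (humul y z)
      continuous_toFun := hcont.subtype_mk hmem }
  exact ⟨χ, fun h => hφu (congrArg (fun z : Circle => (z : ℂ)) h)⟩

section HarmonicAnalysis

open Filter NNReal

variable {X : Type*} [CommGroup X] [TopologicalSpace X]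

/-- A character, seen as a complex-valued continuous function. -/
noncomputable def charFun (χ : PontryaginDual X) : C(X, ℂ) :=
  ⟨fun x => (χ x : ℂ), by fun_prop⟩

@[simp] lemma charFun_apply (χ : PontryaginDual X) (x : X) : charFun χ x = (χ x : ℂ) := rfl

lemma charFun_one : charFun (1 : PontryaginDual X) = 1 := by ext x; simp

lemma charFun_mul (χ ψ : PontryaginDual X) : charFun (χ * ψ) = charFun χ * charFun ψ := by
  ext x
  exact Circle.coe_mul (χ x) (ψ x)

lemma charFun_inv (χ : PontryaginDual X) : charFun χ⁻¹ = star (charFun χ) := by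
  ext x
  exact Circle.coe_inv_eq_conj (χ x)

/-- A linear span of a point-separating group of characters is uniformly dense. -/
lemma span_charFun_topologicalClosure [CompactSpace X] (S : Subgroup (PontryaginDual X))
    (hS : ∀ x : X, x ≠ 1 → ∃ χ ∈ S, χ x ≠ 1) :
    (Submodule.span ℂ (charFun '' (S : Set (PontryaginDual X)))).topologicalClosure = ⊤ := by
  let A : StarSubalgebra ℂ C(X, ℂ) :=
    { toSubalgebra := Algebra.adjoin ℂ (charFun '' (S : Set (PontryaginDual X)))
      star_mem' := by
        change Algebra.adjoin ℂ (charFun '' (S : Set (PontryaginDual X))) ≤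
          star (Algebra.adjoin ℂ (charFun '' (S : Set (PontryaginDual X))))
        refine Algebra.adjoin_le ?_
        rintro - ⟨χ, hχ, rfl⟩
        exact Algebra.subset_adjoin ⟨χ⁻¹, S.inv_mem hχ, charFun_inv χ⟩ }
  have hA : Subalgebra.toSubmodule A.toSubalgebra =
      Submodule.span ℂ (charFun '' (S : Set (PontryaginDual X))) := by
    apply Algebra.adjoin_eq_span_of_subset
    refine Subset.trans ?_ Submodule.subset_span
    intro f hf
    refine Submonoid.closure_induction (fun _ => id) ⟨1, S.one_mem, charFun_one⟩ ?_ hf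
    rintro - - - - ⟨χ, hχ, rfl⟩ ⟨ψ, hψ, rfl⟩
    exact ⟨χ * ψ, S.mul_mem hχ hψ, charFun_mul χ ψ⟩
  rw [← hA]
  refine congr_arg (Subalgebra.toSubmodule <| StarSubalgebra.toSubalgebra ·)
    (ContinuousMap.starSubalgebra_topologicalClosure_eq_top_of_separatesPoints A ?_)
  intro x y hxy
  obtain ⟨χ, hχ, hne⟩ := hS (x / y) (div_ne_one.mpr hxy)
  refine ⟨_, ⟨charFun χ, Algebra.subset_adjoin ⟨χ, hχ, rfl⟩, rfl⟩, fun h => hne ?_⟩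
  rw [map_div, div_eq_one]
  exact Circle.ext h

/-- Uniformly bounded functionals converging on characters converge on all continuous functions. -/
lemma tendsto_of_forall_charFun [CompactSpace X] {S : Subgroup (PontryaginDual X)}
    (hS : ∀ x : X, x ≠ 1 → ∃ χ ∈ S, χ x ≠ 1) (F : ℕ → C(X, ℂ) →ₗ[ℂ] ℂ) (f : C(X, ℂ) →ₗ[ℂ] ℂ)
    (C : ℝ≥0) (hF : ∀ n h, ‖F n h‖ ≤ C * ‖h‖) (hf : ∀ h, ‖f h‖ ≤ C * ‖h‖)
    (hχ : ∀ χ ∈ S, Tendsto (fun n => F n (charFun χ)) atTop (𝓝 (f (charFun χ)))) (h : C(X, ℂ)) :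
    Tendsto (fun n => F n h) atTop (𝓝 (f h)) := by
  have hcl : IsClosed {h | Tendsto (fun n => F n h) atTop (𝓝 (f h))} :=
    Equicontinuous.isClosed_setOfPred_tendsto (F := fun n h => F n h)
      (LipschitzWith.uniformEquicontinuous _ C fun n =>
        AddMonoidHomClass.lipschitz_of_bound_nnnorm (F n) C (hF n)).equicontinuous
      (AddMonoidHomClass.continuous_of_bound f C hf)
  have hspan : (Submodule.span ℂ (charFun '' (S : Set (PontryaginDual X))) : Set C(X, ℂ)) ⊆
      {h | Tendsto (fun n => F n h) atTop (𝓝 (f h))} := by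
    intro h hh
    induction hh using Submodule.span_induction with
    | mem h hh =>
      obtain ⟨χ, hχS, rfl⟩ := hh
      exact hχ χ hχS
    | zero => simp
    | add a b _ _ ha hb => simpa using ha.add hb
    | smul c a _ ha => simpa using ha.const_mul c
  refine closure_minimal hspan hcl ?_
  rw [← Submodule.topologicalClosure_coe, span_charFun_topologicalClosure S hS]
  trivial

variable [IsTopologicalGroup X] [CompactSpace X] [MeasurableSpace X] [BorelSpace X]
  (μ : Measure X)

lemma integral_charFun_eq_zero [μ.IsMulLeftInvariant] {χ : PontryaginDual X}
    (hχ : χ ≠ 1) : ∫ x, charFun χ x ∂μ = 0 := by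
  obtain ⟨y, hy⟩ := DFunLike.ne_iff.mp hχ
  have h : (χ y : ℂ) * ∫ x, charFun χ x ∂μ = ∫ x, charFun χ x ∂μ := by
    rw [← integral_const_mul, ← integral_mul_left_eq_self (fun x => charFun χ x) y]
    simp
  have h' : ((χ y : ℂ) - 1) * ∫ x, charFun χ x ∂μ = 0 := by rw [sub_mul, h, one_mul, sub_self]
  refine (mul_eq_zero.mp h').resolve_left fun h0 => hy ?_
  exact Circle.ext (sub_eq_zero.mp h0)

lemma integrable_continuousMap [IsFiniteMeasure μ] (f : C(X, ℂ)) : Integrable f μ :=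
  f.continuous.integrable_of_hasCompactSupport (HasCompactSupport.of_compactSpace _)

lemma norm_integral_continuousMap_le [IsProbabilityMeasure μ] (f : C(X, ℂ)) :
    ‖∫ x, f x ∂μ‖ ≤ ‖f‖ := by
  simpa using norm_integral_le_of_norm_le_const (μ := μ) (.of_forall f.norm_coe_le_norm)

/-- Integration as a linear functional on continuous functions. -/
noncomputable def integralLM [IsFiniteMeasure μ] : C(X, ℂ) →ₗ[ℂ] ℂ where
  toFun f := ∫ x, f x ∂μ
  map_add' f g := integral_add (integrable_continuousMap μ f) (integrable_continuousMap μ g)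
  map_smul' c _ := integral_const_mul c _

lemma integralLM_charFun [IsProbabilityMeasure μ] [μ.IsMulLeftInvariant]
    (χ : PontryaginDual X) [Decidable (χ = 1)] :
    integralLM μ (charFun χ) = if χ = 1 then 1 else 0 := by
  split_ifs with h
  · simp [h, integralLM]
  · exact integral_charFun_eq_zero μ h

/-- A point-separating group of characters of a compact group is the whole dual. -/
lemma mem_of_separatesPoints {S : Subgroup (PontryaginDual X)}
    (hS : ∀ x : X, x ≠ 1 → ∃ χ ∈ S, χ x ≠ 1) (χ : PontryaginDual X) : χ ∈ S := by
  classical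
  let μ : Measure X := Measure.haarMeasure ⊤
  have : IsProbabilityMeasure μ := ⟨Measure.haarMeasure_self⟩
  by_contra hχ
  let F : C(X, ℂ) →ₗ[ℂ] ℂ := integralLM μ ∘ₗ LinearMap.mulLeft ℂ (charFun χ⁻¹)
  have hF : ∀ h, ‖F h‖ ≤ ‖charFun χ⁻¹‖₊ * ‖h‖ := fun h =>
    (norm_integral_continuousMap_le μ _).trans (norm_mul_le _ _)
  have key := tendsto_of_forall_charFun hS (fun _ => F) 0 _ (fun _ => hF)
    (fun h => by simpa using by positivity) (fun ψ hψ => by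
    have : F (charFun ψ) = 0 := by
      change integralLM μ (charFun χ⁻¹ * charFun ψ) = 0
      rw [← charFun_mul, integralLM_charFun, if_neg]
      intro h
      rw [inv_mul_eq_one] at h
      exact hχ (h ▸ hψ)
    simp [this]) (charFun χ)
  have h1 : F (charFun χ) = 1 := by
    change integralLM μ (charFun χ⁻¹ * charFun χ) = 1
    rw [← charFun_mul, integralLM_charFun, if_pos (inv_mul_cancel χ)]
  exact one_ne_zero (h1.symm.trans (tendsto_nhds_unique tendsto_const_nhds key))

/-- The correlation functional `f ↦ ∫ f · (g ∘ T)`, bilinear in `f` and `g`. -/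
noncomputable def correlation [IsFiniteMeasure μ] (T : X →ₜ* X) :
    C(X, ℂ) →ₗ[ℂ] C(X, ℂ) →ₗ[ℂ] ℂ :=
  LinearMap.mk₂ ℂ (fun f g => integralLM μ (f * g.comp (T : C(X, X))))
    (fun f f' g => by rw [add_mul, map_add]) (fun c f g => by rw [smul_mul_assoc, map_smul])
    (fun f g g' => by rw [ContinuousMap.add_comp, mul_add, map_add])
    (fun c f g => by rw [ContinuousMap.smul_comp, mul_smul_comm, map_smul])

lemma norm_correlation_le [IsProbabilityMeasure μ] (T : X →ₜ* X) (f g : C(X, ℂ)) :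
    ‖correlation μ T f g‖ ≤ ‖f‖ * ‖g‖ := by
  refine (norm_integral_continuousMap_le μ _).trans ((norm_mul_le _ _).trans ?_)
  gcongr
  exact (ContinuousMap.norm_le _ (norm_nonneg _)).mpr fun x => g.norm_coe_le_norm _

/-- Mixing on a point-separating group of characters implies mixing. -/
lemma tendsto_correlation [IsProbabilityMeasure μ] [μ.IsMulLeftInvariant]
    {S : Subgroup (PontryaginDual X)} (hS : ∀ x : X, x ≠ 1 → ∃ χ ∈ S, χ x ≠ 1)
    (T : ℕ → (X →ₜ* X))
    (hT : ∀ χ ∈ S, χ ≠ 1 → ∀ ψ ∈ S, ∀ᶠ n in atTop, ψ * PontryaginDual.map (T n) χ ≠ 1)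
    (f g : C(X, ℂ)) :
    Tendsto (fun n => correlation μ (T n) f g) atTop (𝓝 (integralLM μ f * integralLM μ g)) := by
  classical
  refine tendsto_of_forall_charFun hS (fun n => correlation μ (T n) f)
    (integralLM μ f • integralLM μ) ‖f‖₊ (fun n h => norm_correlation_le μ _ _ _)
    (fun h => ?_) (fun χ hχ => ?_) g
  · rw [LinearMap.smul_apply, norm_smul]
    exact mul_le_mul (norm_integral_continuousMap_le μ f) (norm_integral_continuousMap_le μ h)
      (norm_nonneg _) (norm_nonneg _)
  refine tendsto_of_forall_charFun hS (fun n => (correlation μ (T n)).flip (charFun χ))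
    (integralLM μ (charFun χ) • integralLM μ) ‖charFun χ‖₊
    (fun n h => (norm_correlation_le μ _ _ _).trans_eq (mul_comm _ _))
    (fun h => ?_) (fun ψ hψ => ?_) f |>.trans_eq ?_
  · rw [LinearMap.smul_apply, norm_smul]
    exact mul_le_mul (norm_integral_continuousMap_le μ _) (norm_integral_continuousMap_le μ h)
      (norm_nonneg _) (norm_nonneg _)
  · have hcomp : ∀ n, correlation μ (T n) (charFun ψ) (charFun χ) =
        integralLM μ (charFun (ψ * PontryaginDual.map (T n) χ)) := fun n => by
      rw [charFun_mul]; rfl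
    simp only [LinearMap.flip_apply, hcomp, integralLM_charFun, LinearMap.smul_apply, smul_eq_mul]
    by_cases h : χ = 1
    · simp [h]
    · refine (tendsto_congr' ?_).mpr tendsto_const_nhds
      filter_upwards [hT χ hχ h ψ hψ] with n hn
      simp [hn, h]
  · simp [mul_comm]

/-- A mixing sequence of endomorphisms of a nontrivial group has a nontrivial point whose
orbit accumulates at the identity. -/
lemma exists_mem_closure_of_mixing [FirstCountableTopology X] [T2Space X] [Nontrivial X]
    {S : Subgroup (PontryaginDual X)} (hS : ∀ x : X, x ≠ 1 → ∃ χ ∈ S, χ x ≠ 1)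
    (T : ℕ → (X →ₜ* X))
    (hT : ∀ χ ∈ S, χ ≠ 1 → ∀ ψ ∈ S, ∀ᶠ n in atTop, ψ * PontryaginDual.map (T n) χ ≠ 1) :
    ∃ x : X, x ≠ 1 ∧ (1 : X) ∈ closure (range fun n => T n x) := by
  let μ : Measure X := Measure.haarMeasure ⊤
  have : IsProbabilityMeasure μ := ⟨Measure.haarMeasure_self⟩
  have bump : ∀ U : Set X, IsOpen U → U.Nonempty →
      ∃ f : C(X, ℂ), (∀ x ∉ U, f x = 0) ∧ integralLM μ f ≠ 0 := by
    rintro U hU ⟨u, hu⟩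
    obtain ⟨f, hf0, hf1, hf⟩ := exists_continuous_zero_one_of_isClosed hU.isClosed_compl
      (isClosed_singleton (x := u)) (by simpa using hu)
    refine ⟨⟨fun x => (f x : ℂ), by fun_prop⟩, fun x hx => by simpa using hf0 hx, ?_⟩
    have hpos : 0 < ∫ x, f x ∂μ := f.continuous.integral_pos_of_hasCompactSupport_nonneg_nonzero
      (HasCompactSupport.of_compactSpace _) (fun x => (hf x).1) (x := u)
      (by simp [hf1 (mem_singleton u)])
    change ∫ x, (f x : ℂ) ∂μ ≠ 0
    rw [integral_complex_ofReal]
    exact_mod_cast hpos.ne'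
  have hdense : ∀ V : Set X, IsOpen V → V.Nonempty → Dense (⋃ n, T n ⁻¹' V) := by
    intro V hV hVne
    rw [dense_iff_inter_open]
    intro U hU hUne
    obtain ⟨f, hf, hfi⟩ := bump U hU hUne
    obtain ⟨g, hg, hgi⟩ := bump V hV hVne
    obtain ⟨n, hn⟩ := ((tendsto_correlation μ hS T hT f g).eventually_ne
      (mul_ne_zero hfi hgi)).exists
    by_contra hempty
    refine hn (integral_eq_zero_of_ae (.of_forall fun x => ?_))
    by_cases hx : x ∈ U
    · have : T n x ∉ V := fun h => hempty ⟨x, hx, mem_iUnion.mpr ⟨n, h⟩⟩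
      simp [hg _ this]
    · simp [hf _ hx]
  obtain ⟨V, hV, hVo⟩ : ∃ V : ℕ → Set X, (𝓝 (1 : X)).HasBasis (fun _ => True) V ∧
      ∀ k, IsOpen (V k) := by
    obtain ⟨V, hV⟩ := (𝓝 (1 : X)).exists_antitone_basis
    refine ⟨fun k => interior (V k), ?_, fun k => isOpen_interior⟩
    exact hV.1.to_hasBasis (fun k _ => ⟨k, trivial, interior_subset⟩) fun k _ => by
      obtain ⟨j, hj, hj'⟩ := hV.1.mem_iff.mp (interior_mem_nhds.mpr (hV.mem k))
      exact ⟨j, trivial, hj'⟩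
  have hB : Dense (⋂ k, ⋃ n, T n ⁻¹' V k) := dense_iInter_of_isOpen
    (fun k => isOpen_iUnion fun n => (hVo k).preimage (map_continuous (T n)))
    (fun k => hdense _ (hVo k) ⟨1, mem_of_mem_nhds (hV.mem_of_mem trivial)⟩)
  obtain ⟨x, hx1, hx⟩ := hB.inter_open_nonempty {1}ᶜ isOpen_compl_singleton
    (exists_ne (1 : X))
  refine ⟨x, hx1, (mem_closure_iff_nhds_basis hV).mpr fun k _ => ?_⟩
  obtain ⟨n, hn⟩ := mem_iUnion.mp (mem_iInter.mp hx k)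
  exact ⟨T n x, mem_range_self n, hn⟩

end HarmonicAnalysis

section Duality

open Filter

variable {K : Type*} [CommGroup K] [TopologicalSpace K]

/-- A bicontinuous automorphism as a continuous homomorphism. -/
def ContAut.toHom (α : ↥(ContAut K)) : K →ₜ* K :=
  ⟨(α : MulAut K).toMonoidHom, ContAut.continuous α⟩

/-- The action of automorphisms on characters, `γ • χ = χ ∘ γ⁻¹`. -/
noncomputable instance : MulDistribMulAction ↥(ContAut K) (PontryaginDual K) where
  smul γ χ := PontryaginDual.map (ContAut.toHom γ⁻¹) χ
  one_smul χ := PontryaginDual.ext fun x => by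
    change χ ((((1 : ↥(ContAut K))⁻¹ : ↥(ContAut K)) : MulAut K) x) = χ x
    simp
  mul_smul γ γ' χ := PontryaginDual.ext fun x => by
    change χ ((((γ * γ')⁻¹ : ↥(ContAut K)) : MulAut K) x) =
      χ ((((γ')⁻¹ : ↥(ContAut K)) : MulAut K) (((γ⁻¹ : ↥(ContAut K)) : MulAut K) x))
    rw [mul_inv_rev]
    rfl
  smul_mul γ χ ψ := map_mul (PontryaginDual.map (ContAut.toHom γ⁻¹)) χ ψ
  smul_one γ := map_one (PontryaginDual.map (ContAut.toHom γ⁻¹))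

lemma smul_char_apply (γ : ↥(ContAut K)) (χ : PontryaginDual K) (x : K) :
    (γ • χ) x = χ (((γ⁻¹ : ↥(ContAut K)) : MulAut K) x) := rfl

lemma char_mul_apply (χ ψ : PontryaginDual K) (x : K) : (χ * ψ) x = χ x * ψ x := rfl

lemma char_inv_apply (χ : PontryaginDual K) (x : K) : χ⁻¹ x = (χ x)⁻¹ := rfl

/-- The common kernel of a group of characters. -/
def annihilator (E : Subgroup (PontryaginDual K)) : Subgroup K where
  carrier := {x | ∀ χ ∈ E, χ x = 1}
  one_mem' χ _ := map_one χ
  mul_mem' {x y} hx hy χ hχ := by rw [map_mul, hx χ hχ, hy χ hχ, one_mul]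
  inv_mem' {x} hx χ hχ := by rw [map_inv, hx χ hχ, inv_one]

lemma isClosed_annihilator (E : Subgroup (PontryaginDual K)) :
    IsClosed (annihilator E : Set K) := by
  have : (annihilator E : Set K) = ⋂ χ ∈ E, {x | χ x = 1} := by
    ext x
    simp [annihilator]
  rw [this]
  exact isClosed_biInter fun χ _ => isClosed_eq (map_continuous χ) continuous_const

lemma smul_mem_annihilator {E : Subgroup (PontryaginDual K)} {γ : ↥(ContAut K)}
    (hE : ∀ χ ∈ E, γ⁻¹ • χ ∈ E) {x : K} (hx : x ∈ annihilator E) :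
    (γ : MulAut K) x ∈ annihilator E := fun χ hχ => by
  simpa [smul_char_apply] using hx _ (hE χ hχ)

variable [IsTopologicalGroup K] [CompactSpace K]

/-- Double annihilator: a character trivial on the annihilator of `E` lies in `E`. -/
lemma mem_of_forall_annihilator {E : Subgroup (PontryaginDual K)} {χ : PontryaginDual K}
    (hχ : ∀ x ∈ annihilator E, χ x = 1) : χ ∈ E := by
  let L := annihilator E
  let π : K →ₜ* K ⧸ L := ⟨QuotientGroup.mk' L, QuotientGroup.continuous_mk⟩
  have hdesc : ∀ ψ : PontryaginDual K, (∀ x ∈ L, ψ x = 1) →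
      ∃ ψ' : PontryaginDual (K ⧸ L), PontryaginDual.map π ψ' = ψ := by
    intro ψ hψ
    let ψ' : K ⧸ L →ₜ* Circle := ⟨QuotientGroup.lift L (ψ : K →* Circle) hψ,
      (QuotientGroup.isQuotientMap_mk L).continuous_iff.mpr (map_continuous ψ)⟩
    exact ⟨ψ', PontryaginDual.ext fun x => rfl⟩
  let S : Subgroup (PontryaginDual (K ⧸ L)) := E.comap (PontryaginDual.map π).toMonoidHom
  have hS : ∀ x : K ⧸ L, x ≠ 1 → ∃ ψ ∈ S, ψ x ≠ 1 := by
    intro x hx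
    obtain ⟨y, rfl⟩ := QuotientGroup.mk_surjective x
    have hy : y ∉ L := fun h => hx ((QuotientGroup.eq_one_iff y).mpr h)
    obtain ⟨ψ, hψE, hψ⟩ : ∃ ψ ∈ E, ψ y ≠ 1 := by
      by_contra! h
      exact hy h
    obtain ⟨ψ', rfl⟩ := hdesc ψ fun z hz => hz ψ hψE
    exact ⟨ψ', hψE, hψ⟩
  let _ : MeasurableSpace (K ⧸ L) := borel _
  have : BorelSpace (K ⧸ L) := ⟨rfl⟩
  obtain ⟨χ', rfl⟩ := hdesc χ hχ
  exact mem_of_separatesPoints hS χ'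

variable [TopologicalSpace.MetrizableSpace K]

/-- A distal automorphism has a periodic character modulo any proper invariant subgroup. -/
lemma exists_periodic_of_distalAut {α : ↥(ContAut K)} (hα : DistalAut α)
    {E : Subgroup (PontryaginDual K)} (hE : ∀ χ ∈ E, α • χ ∈ E) (hE' : ∀ χ ∈ E, α⁻¹ • χ ∈ E)
    (hne : E ≠ ⊤) : ∃ χ ∉ E, ∃ k : ℕ, 0 < k ∧ (α ^ k • χ) / χ ∈ E := by
  by_contra! hper
  have hpow : ∀ n : ℕ, ∀ χ ∈ E, α ^ n • χ ∈ E := fun n => by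
    induction n with
    | zero => simp
    | succ n ih =>
      intro χ hχ
      rw [pow_succ', mul_smul]
      exact hE _ (ih χ hχ)
  have hpow' : ∀ n : ℕ, ∀ χ ∈ E, (α ^ n)⁻¹ • χ ∈ E := fun n => by
    induction n with
    | zero => simp
    | succ n ih =>
      intro χ hχ
      rw [pow_succ, mul_inv_rev, mul_smul]
      exact hE' _ (ih χ hχ)
  let L := annihilator E
  have hLc : IsClosed (L : Set K) := isClosed_annihilator E
  have : CompactSpace L := isCompact_iff_compactSpace.mp hLc.isCompact
  have : Nontrivial L := by
    by_contra h
    rw [not_nontrivial_iff_subsingleton] at h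
    refine hne (eq_top_iff.mpr fun χ _ => mem_of_forall_annihilator fun x hx => ?_)
    have : (⟨x, hx⟩ : L) = 1 := Subsingleton.elim _ _
    rw [show x = 1 from congrArg Subtype.val this, map_one]
  let ι : L →ₜ* K := ⟨L.subtype, continuous_subtype_val⟩
  have hinv : ∀ n : ℕ, ∀ x ∈ L, (((α ^ n)⁻¹ : ↥(ContAut K)) : MulAut K) x ∈ L := fun n x hx =>
    smul_mem_annihilator (γ := (α ^ n)⁻¹) (by simpa using hpow n) hx
  let T : ℕ → (L →ₜ* L) := fun n =>
    ⟨((ContAut.toHom (α ^ n)⁻¹ : K →* K).comp L.subtype).codRestrict L fun x => hinv n x x.2,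
      ((ContAut.continuous (α ^ n)⁻¹).comp continuous_subtype_val).subtype_mk
        fun x => hinv n x x.2⟩
  let S : Subgroup (PontryaginDual L) := (PontryaginDual.map ι).toMonoidHom.range
  have hS : ∀ x : L, x ≠ 1 → ∃ χ ∈ S, χ x ≠ 1 := by
    intro x hx
    obtain ⟨χ, hχ⟩ := exists_pontryaginDual_ne_one (x := (x : K)) (by simpa using hx)
    exact ⟨PontryaginDual.map ι χ, ⟨χ, rfl⟩, hχ⟩
  have hT : ∀ χ ∈ S, χ ≠ 1 → ∀ ψ ∈ S,
      ∀ᶠ n in atTop, ψ * PontryaginDual.map (T n) χ ≠ 1 := by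
    rintro - ⟨χ, rfl⟩ hχ - ⟨ψ, rfl⟩
    by_contra hev
    rw [not_eventually] at hev
    have hmem : ∀ n, ¬ (PontryaginDual.map ι ψ *
        PontryaginDual.map (T n) (PontryaginDual.map ι χ) ≠ 1) → ψ * α ^ n • χ ∈ E := by
      intro n hn
      rw [not_not] at hn
      exact mem_of_forall_annihilator fun x hx => DFunLike.congr_fun hn ⟨x, hx⟩
    obtain ⟨n, hn⟩ := hev.exists
    obtain ⟨m, hnm, hm⟩ := (hev.and_eventually (eventually_gt_atTop n)).exists.imp
      fun m h => h.symm
    have hd := E.div_mem (hmem m hm) (hmem n hn)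
    rw [mul_div_mul_left_eq_div] at hd
    refine hper χ (fun h => hχ (PontryaginDual.ext fun x => x.2 χ h)) (m - n)
      (Nat.sub_pos_of_lt hnm) ?_
    have := hpow' n _ hd
    rwa [smul_div', inv_smul_smul, ← mul_smul, ← pow_mul_pow_sub α hnm.le,
      inv_mul_cancel_left] at this
  have : FirstCountableTopology L := IsInducing.subtypeVal.firstCountableTopology
  let _ : MeasurableSpace L := borel _
  have : BorelSpace L := ⟨rfl⟩
  obtain ⟨x, hx, hcl⟩ := exists_mem_closure_of_mixing hS T hT
  refine hα (x : K) (by simpa using hx) ?_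
  have := image_closure_subset_closure_image (continuous_subtype_val (p := (· ∈ L)))
    (mem_image_of_mem _ hcl)
  refine closure_mono ?_ this
  rintro - ⟨-, ⟨n, rfl⟩, rfl⟩
  exact ⟨(α ^ n)⁻¹, ⟨-n, by simp⟩, rfl⟩

end Duality

section Algebra

open Polynomial Pointwise

variable {G A : Type*} [Group G] [AddCommGroup A] [DistribMulAction G A]

/-- An element of `G` having periodic elements modulo every proper invariant subgroup acts
in a locally quasi-unipotent way. -/
lemma exists_pow_sub_one_pow_eq_zero {g : G}
    (hg : ∀ E : AddSubgroup A, (∀ a ∈ E, g • a ∈ E) → (∀ a ∈ E, g⁻¹ • a ∈ E) → E ≠ ⊤ →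
      ∃ a ∉ E, ∃ k : ℕ, 0 < k ∧ g ^ k • a - a ∈ E) (a : A) :
    ∃ k : ℕ, 0 < k ∧ ∃ m : ℕ, ((DistribMulAction.toAddMonoidEnd G A g ^ k - 1) ^ m) a = 0 := by
  set s := DistribMulAction.toAddMonoidEnd G A g with hs
  have hsa : ∀ a, s a = g • a := fun a => rfl
  have hdvd : ∀ {p q : ℤ[X]}, p ∣ q → ∀ a, aeval s p a = 0 → aeval s q a = 0 := by
    rintro p - ⟨r, rfl⟩ a ha
    rw [mul_comm, map_mul, AddMonoid.End.coe_mul, Function.comp_apply, ha, map_zero]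
  have hkm : ∀ {k k' m m' : ℕ}, m ≤ m' →
      ((X ^ k - 1) ^ m : ℤ[X]) ∣ (X ^ (k * k') - 1) ^ m' := fun {k k' m m'} h =>
    (pow_dvd_pow _ h).trans (pow_dvd_pow_of_dvd
      (by simpa [pow_mul] using sub_dvd_pow_sub_pow (X ^ k : ℤ[X]) 1 k') _)
  have hcomm : ∀ (p : ℤ[X]) a, aeval s p (g • a) = g • aeval s p a := fun p a => by
    have : aeval s (p * X) = aeval s (X * p) := by rw [mul_comm]
    simpa [hsa] using DFunLike.congr_fun this a
  let N : AddSubgroup A :=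
    { carrier := {a | ∃ k : ℕ, 0 < k ∧ ∃ m : ℕ, aeval s ((X ^ k - 1) ^ m : ℤ[X]) a = 0}
      zero_mem' := ⟨1, one_pos, 0, map_zero _⟩
      add_mem' := by
        rintro a b ⟨k, hk, m, ha⟩ ⟨k', hk', m', hb⟩
        refine ⟨k * k', Nat.mul_pos hk hk', max m m', ?_⟩
        rw [map_add, hdvd (hkm (le_max_left _ _)) a ha, zero_add, mul_comm k,
          hdvd (hkm (le_max_right _ _)) b hb]
      neg_mem' := by
        rintro a ⟨k, hk, m, ha⟩
        exact ⟨k, hk, m, by rw [map_neg, ha, neg_zero]⟩ }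
  suffices N = ⊤ by
    obtain ⟨k, hk, m, h⟩ := (this ▸ AddSubgroup.mem_top a : a ∈ N)
    exact ⟨k, hk, m, by simpa using h⟩
  by_contra hN
  obtain ⟨a, ha, k, hk, k', hk', m, h⟩ := hg N
    (fun a ⟨k, hk, m, h⟩ => ⟨k, hk, m, by rw [hcomm, h, smul_zero]⟩)
    (fun a ⟨k, hk, m, h⟩ => ⟨k, hk, m, by
      rw [← smul_eq_zero_iff_eq g, ← hcomm, smul_inv_smul, h]⟩) hN
  refine ha ⟨k' * k, Nat.mul_pos hk' hk, m + 1, ?_⟩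
  have hpow : ∀ n : ℕ, (s ^ n) a = g ^ n • a := fun n => by rw [hs, ← map_pow]; rfl
  refine hdvd (p := (X ^ k' - 1) ^ m * (X ^ k - 1)) ?_ a ?_
  · rw [pow_succ]
    refine mul_dvd_mul (hkm le_rfl) ?_
    simpa [mul_comm k'] using hkm (k := k) (k' := k') (m := 1) le_rfl
  · have : aeval s (X ^ k - 1 : ℤ[X]) a = g ^ k • a - a := by
      rw [map_sub, map_pow, aeval_X, map_one, ← hpow]
      rfl
    rw [map_mul, AddMonoid.End.coe_mul, Function.comp_apply, this, h]

/-- The `H`-orbit of `a` meets only finitely many cosets of `E`. -/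
def FiniteOrbitMod (E : AddSubgroup A) (H : Subgroup G) (a : A) : Prop :=
  ∃ O : Set A, O.Finite ∧ ∀ h ∈ H, ∃ o ∈ O, h • a - o ∈ E

variable {E : AddSubgroup A} {H : Subgroup G}

lemma FiniteOrbitMod.sub {a b : A} (ha : FiniteOrbitMod E H a) (hb : FiniteOrbitMod E H b) :
    FiniteOrbitMod E H (a - b) := by
  obtain ⟨O, hO, ha⟩ := ha
  obtain ⟨O', hO', hb⟩ := hb
  refine ⟨O - O', hO.sub hO', fun h hh => ?_⟩
  obtain ⟨o, ho, hoE⟩ := ha h hh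
  obtain ⟨o', ho', hoE'⟩ := hb h hh
  exact ⟨o - o', sub_mem_sub ho ho', by
    rw [smul_sub, sub_sub_sub_comm]; exact E.sub_mem hoE hoE'⟩

lemma FiniteOrbitMod.smul [H.Normal] (hE : ∀ g : G, ∀ a ∈ E, g • a ∈ E) {a : A}
    (ha : FiniteOrbitMod E H a) (g : G) : FiniteOrbitMod E H (g • a) := by
  obtain ⟨O, hO, ha⟩ := ha
  refine ⟨g • O, hO.smul_set, fun h hh => ?_⟩
  obtain ⟨o, ho, hoE⟩ := ha (g⁻¹ * h * g) (by simpa using Subgroup.Normal.conj_mem ‹_› h hh g⁻¹)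
  refine ⟨g • o, smul_mem_smul_set ho, ?_⟩
  have := hE g _ hoE
  rwa [smul_sub, ← mul_smul, mul_assoc, mul_inv_cancel_left, mul_smul] at this

/-- The elements fixing `a` modulo an invariant subgroup. -/
def stabilizerMod (hE : ∀ g : G, ∀ a ∈ E, g • a ∈ E) (a : A) : Subgroup G where
  carrier := {g | g • a - a ∈ E}
  one_mem' := by simp
  mul_mem' {g g'} hg hg' := by
    have := E.add_mem (hE g _ hg') hg
    rwa [smul_sub, sub_add_sub_cancel, ← mul_smul] at this
  inv_mem' {g} hg := by
    have := E.neg_mem (hE g⁻¹ _ hg)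
    rwa [smul_sub, inv_smul_smul, neg_sub] at this

lemma FiniteOrbitMod.sup_zpowers [H.Normal] (hE : ∀ g : G, ∀ a ∈ E, g • a ∈ E) {b : A}
    (hb : FiniteOrbitMod E H b) {g : G} {k : ℕ} (hk : 0 < k) (hg : g ^ k • b - b ∈ E) :
    FiniteOrbitMod E (H ⊔ Subgroup.zpowers g) b := by
  choose O hO hOE using fun j : ℕ => hb.smul hE (g ^ j)
  refine ⟨⋃ j ∈ Finset.range k, O j, Set.Finite.biUnion (Finset.finite_toSet _) fun j _ => hO j, ?_⟩
  intro x hx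
  obtain ⟨h, hh, -, ⟨j, rfl⟩, rfl⟩ := Subgroup.mem_sup_of_normal_left.mp hx
  have hk' : (0 : ℤ) < k := by exact_mod_cast hk
  obtain ⟨r, hr⟩ := Int.eq_ofNat_of_zero_le (Int.emod_nonneg j hk'.ne')
  have hrk : r < k := by have := Int.emod_lt_of_pos j hk'; omega
  obtain ⟨o, ho, hoE⟩ := hOE r h hh
  refine ⟨o, mem_biUnion (Finset.mem_coe.mpr (Finset.mem_range.mpr hrk)) ho, ?_⟩
  have hj : g ^ j = g ^ r * (g ^ k) ^ (j / k) := by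
    rw [← zpow_natCast g r, ← zpow_natCast g k, ← zpow_mul, ← zpow_add, ← hr, Int.emod_add_mul_ediv]
  have hst : (g ^ k) ^ (j / k) • b - b ∈ E :=
    (stabilizerMod hE b).zpow_mem (x := g ^ k) hg (j / k)
  have := E.add_mem (hE (h * g ^ r) _ hst) hoE
  rwa [smul_sub, ← mul_smul h (g ^ r) b, sub_add_sub_cancel, ← mul_smul, mul_assoc, ← hj] at this

/-- If `G` is generated by a normal subgroup `Δ` with finite orbits and abelian quotient, and by
finitely many locally quasi-unipotent elements, then modulo every proper invariant
subgroup there is a nonzero element with finite orbit. -/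
lemma exists_finiteOrbitMod {Δ : Subgroup G} (hΔ : ∀ a : A, FiniteOrbitMod E Δ a)
    (hcomm : ∀ a b : G, a * b * a⁻¹ * b⁻¹ ∈ Δ) (hE : ∀ g : G, ∀ a ∈ E, g • a ∈ E) (hne : E ≠ ⊤)
    {S : Set G} (hS : S.Finite) (hqu : ∀ g ∈ S, ∀ a : A,
      ∃ k : ℕ, 0 < k ∧ ∃ m : ℕ, ((DistribMulAction.toAddMonoidEnd G A g ^ k - 1) ^ m) a = 0) :
    ∃ a ∉ E, FiniteOrbitMod E (Δ ⊔ Subgroup.closure S) a := by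
  induction S, hS using Set.Finite.induction_on with
  | empty =>
    obtain ⟨a, ha⟩ : ∃ a, a ∉ E := by
      by_contra! h
      exact hne (eq_top_iff.mpr fun a _ => h a)
    exact ⟨a, ha, by simpa using hΔ a⟩
  | @insert g S _ _ ih =>
    obtain ⟨a, haE, ha⟩ := ih fun g hg => hqu g (mem_insert_of_mem _ hg)
    set H := Δ ⊔ Subgroup.closure S with hH
    have : H.Normal := ⟨fun h hh x => by
      simpa using H.mul_mem ((le_sup_left : Δ ≤ H) (hcomm x h)) hh⟩
    obtain ⟨k, hk, m, hm⟩ := hqu g (mem_insert _ _) a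
    set D := DistribMulAction.toAddMonoidEnd G A g ^ k - 1 with hD
    have hDa : ∀ x, D x = g ^ k • x - x := fun x => by
      rw [hD, ← map_pow]
      rfl
    have hex : ∃ m : ℕ, (D ^ m) a ∈ E := ⟨m, hm ▸ E.zero_mem⟩
    classical
    obtain ⟨j, hj⟩ := Nat.exists_eq_succ_of_ne_zero (n := Nat.find hex) fun h0 => haE (by
      have := Nat.find_spec hex
      rwa [h0, pow_zero] at this)
    have hbF : ∀ j : ℕ, FiniteOrbitMod E H ((D ^ j) a) := fun j => by
      induction j with
      | zero => simpa using ha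
      | succ j ihj =>
        rw [pow_succ', AddMonoid.End.coe_mul, Function.comp_apply, hDa]
        exact (ihj.smul hE _).sub ihj
    have hbE : (D ^ j) a ∉ E := Nat.find_min hex (by omega)
    have hDb : g ^ k • (D ^ j) a - (D ^ j) a ∈ E := by
      have := Nat.find_spec hex
      rwa [hj, Nat.succ_eq_add_one, pow_succ', AddMonoid.End.coe_mul, Function.comp_apply, hDa] at this
    refine ⟨_, hbE, ?_⟩
    have hsup : Δ ⊔ Subgroup.closure (insert g S) = H ⊔ Subgroup.zpowers g := by
      rw [insert_eq, Subgroup.closure_union, ← Subgroup.zpowers_eq_closure, hH, sup_assoc, sup_comm (Subgroup.zpowers g)]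
    rw [hsup]
    exact (hbF j).sup_zpowers hE hk hDb

end Algebra

section Distality

variable {K : Type*} [CommGroup K] [TopologicalSpace K]

noncomputable instance : DistribMulAction ↥(ContAut K) (Additive (PontryaginDual K)) where
  smul γ a := Additive.ofMul (γ • a.toMul)
  one_smul a := congrArg Additive.ofMul (one_smul _ a.toMul)
  mul_smul γ γ' a := congrArg Additive.ofMul (mul_smul γ γ' a.toMul)
  smul_add γ a b := congrArg Additive.ofMul (smul_mul' γ a.toMul b.toMul)
  smul_zero γ := congrArg Additive.ofMul (smul_one γ)

variable [CompactSpace K]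

/-- A compact group of automorphisms has finite orbits on characters. -/
lemma finite_smul_char {Δ : Subgroup ↥(ContAut K)} (hcompact : IsCompact ((fun β : ↥(ContAut K) =>
      (⟨⇑(β : MulAut K), ContAut.continuous β⟩ : C(K, K))) '' (Δ : Set ↥(ContAut K))))
    (χ : PontryaginDual K) : ((fun δ : ↥(ContAut K) => δ • χ) '' (Δ : Set ↥(ContAut K))).Finite := by
  let ι : PontryaginDual K → C(K, Circle) := fun ψ => ⟨ψ, map_continuous ψ⟩
  have hι : IsInducing ι := ContinuousMonoidHom.isInducing_toContinuousMap K Circle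
  refine IsCompact.finite_of_discrete ?_
  rw [hι.isCompact_iff]
  convert hcompact.image (ContinuousMap.continuous_postcomp (ι χ)) using 1
  ext f
  constructor
  · rintro ⟨-, ⟨δ, hδ, rfl⟩, rfl⟩
    exact ⟨_, ⟨δ⁻¹, Δ.inv_mem hδ, rfl⟩, rfl⟩
  · rintro ⟨-, ⟨δ, hδ, rfl⟩, rfl⟩
    refine ⟨_, ⟨δ⁻¹, Δ.inv_mem hδ, rfl⟩, ContinuousMap.ext fun x => ?_⟩
    change χ ((((δ⁻¹)⁻¹ : ↥(ContAut K)) : MulAut K) x) = χ ((δ : MulAut K) x)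
    rw [inv_inv]

variable [IsTopologicalGroup K] [TopologicalSpace.MetrizableSpace K]

lemma DistalAut.exists_pow_sub_one_pow_eq_zero {Γ : Subgroup ↥(ContAut K)} {g : Γ}
    (hg : DistalAut (g : ↥(ContAut K))) (a : Additive (PontryaginDual K)) :
    ∃ k : ℕ, 0 < k ∧ ∃ m : ℕ, ((DistribMulAction.toAddMonoidEnd Γ
      (Additive (PontryaginDual K)) g ^ k - 1) ^ m) a = 0 :=
  ErgZd.exists_pow_sub_one_pow_eq_zero (fun E hE hE' hne => by
    obtain ⟨χ, hχ, k, hk, h⟩ := exists_periodic_of_distalAut hg (E := AddSubgroup.toSubgroup' E)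
      hE hE' fun h => hne (AddSubgroup.toSubgroup'.injective (h.trans (map_top _).symm))
    exact ⟨Additive.ofMul χ, hχ, k, hk, h⟩) a

/-- The characters trivial on the orbit of `x`. -/
def orbitAnnihilator (Γ : Subgroup ↥(ContAut K)) (x : K) :
    AddSubgroup (Additive (PontryaginDual K)) where
  carrier := {a | ∀ γ ∈ Γ, a.toMul ((γ : MulAut K) x) = 1}
  zero_mem' _ _ := rfl
  add_mem' {a b} ha hb γ hγ := by
    rw [toMul_add, char_mul_apply, ha γ hγ, hb γ hγ, one_mul]
  neg_mem' {a} ha γ hγ := by rw [toMul_neg, char_inv_apply, ha γ hγ, inv_one]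

lemma smul_mem_orbitAnnihilator {Γ : Subgroup ↥(ContAut K)} {x : K} (g : Γ)
    (a : Additive (PontryaginDual K)) (ha : a ∈ orbitAnnihilator Γ x) :
    g • a ∈ orbitAnnihilator Γ x := fun γ hγ =>
  ha ((g : ↥(ContAut K))⁻¹ * γ) (Γ.mul_mem (Γ.inv_mem g.2) hγ)

/-- If the orbit of `x` accumulates at the identity, then no character outside
`orbitAnnihilator Γ x` has a finite orbit modulo it. -/
lemma mem_orbitAnnihilator_of_finiteOrbitMod {Γ : Subgroup ↥(ContAut K)} {x : K}
    (hx : (1 : K) ∈ closure ((fun α : ↥(ContAut K) => (α : MulAut K) x) '' Γ))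
    {a : Additive (PontryaginDual K)}
    (ha : FiniteOrbitMod (orbitAnnihilator Γ x) (⊤ : Subgroup Γ) a) :
    a ∈ orbitAnnihilator Γ x := by
  obtain ⟨O, hO, hOE⟩ := ha
  have hval : ∀ γ : Γ, ∃ o ∈ O,
      (∀ δ ∈ Γ, (γ • a).toMul ((δ : MulAut K) x) = o.toMul ((δ : MulAut K) x)) := by
    intro γ
    obtain ⟨o, ho, h⟩ := hOE γ trivial
    exact ⟨o, ho, fun δ hδ => div_eq_one.mp (h δ hδ)⟩
  let W : Set Circle := ((fun o : Additive (PontryaginDual K) => o.toMul x) '' O \ {1})ᶜ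
  have hW : IsOpen W := ((hO.image _).subset sdiff_subset).isClosed.isOpen_compl
  have hU : (⋂ o ∈ O, {y : K | o.toMul y ∈ W}) ∈ 𝓝 (1 : K) := by
    refine (Filter.biInter_mem hO).mpr fun o _ => ?_
    refine (hW.preimage (map_continuous o.toMul)).mem_nhds ?_
    simp [W]
  obtain ⟨-, hy, γ₀, hγ₀, rfl⟩ := mem_closure_iff_nhds.mp hx _ hU
  intro γ hγ
  obtain ⟨o, ho, hoV⟩ := hval ⟨γ₀ * γ⁻¹, Γ.mul_mem hγ₀ (Γ.inv_mem hγ)⟩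
  obtain ⟨o', ho', hoV'⟩ := hval ⟨γ⁻¹, Γ.inv_mem hγ⟩
  have h₁ : a.toMul ((γ : MulAut K) x) = o.toMul ((γ₀ : MulAut K) x) := by
    rw [← hoV γ₀ hγ₀]
    change _ = a.toMul ((((γ₀ * γ⁻¹)⁻¹ * γ₀ : ↥(ContAut K)) : MulAut K) x)
    simp
  have h₂ : a.toMul ((γ : MulAut K) x) = o'.toMul x := by
    refine Eq.trans ?_ (hoV' 1 Γ.one_mem)
    change _ = a.toMul ((((γ⁻¹)⁻¹ : ↥(ContAut K)) : MulAut K) x)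
    rw [inv_inv]
  by_contra hne
  have hyW : o.toMul ((γ₀ : MulAut K) x) ∈ W := mem_iInter₂.mp hy o ho
  rw [← h₁] at hyW
  exact hyW ⟨⟨o', ho', h₂.symm⟩, hne⟩

end Distality

/-- Lemma 3.2. Let `K` be a compact metrizable abelian group and `Γ` a
group of continuous automorphisms of `K`. Suppose `Δ` is a normal subgroup of `Γ` which is
compact in the compact-open topology, `Γ/Δ` is abelian, and `Γ` is generated by `Δ`
together with `α 1, …, α n`. Then `Γ` is distal on `K` iff each `α i` is distal on `K`. -/
theorem statement6 {K : Type*} [CommGroup K] [TopologicalSpace K] [IsTopologicalGroup K]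
    [CompactSpace K] [TopologicalSpace.MetrizableSpace K]
    (Γ Δ : Subgroup ↥(ContAut K)) (hΔΓ : Δ ≤ Γ)
    (hnormal : ∀ γ ∈ Γ, ∀ δ ∈ Δ, γ * δ * γ⁻¹ ∈ Δ)
    (hcompact : IsCompact ((fun β : ↥(ContAut K) =>
      (⟨⇑(β : MulAut K), ContAut.continuous β⟩ : C(K, K))) '' (Δ : Set ↥(ContAut K))))
    (habel : ∀ a ∈ Γ, ∀ b ∈ Γ, a * b * a⁻¹ * b⁻¹ ∈ Δ)
    {n : ℕ} (α : Fin n → ↥(ContAut K)) (hmem : ∀ i, α i ∈ Γ)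
    (hgen : Γ = Δ ⊔ Subgroup.closure (Set.range α)) :
    DistalSet (Γ : Set ↥(ContAut K)) ↔ ∀ i, DistalAut (α i) := by
  constructor
  · intro h i x hx hcl
    refine h x hx (closure_mono (image_mono ?_) hcl)
    rintro - ⟨j, rfl⟩
    exact Γ.zpow_mem (hmem i) j
  intro h x hx hcl
  let α' : Fin n → Γ := fun i => ⟨α i, hmem i⟩
  have hgen' : Δ.subgroupOf Γ ⊔ Subgroup.closure (range α') = ⊤ := by
    apply Subgroup.map_injective Γ.subtype_injective
    rw [Subgroup.map_sup, Subgroup.map_subgroupOf_eq_of_le hΔΓ, MonoidHom.map_closure,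
      ← range_comp, ← MonoidHom.range_eq_map, Subgroup.range_subtype]
    exact hgen.symm
  by_cases hE : orbitAnnihilator Γ x = ⊤
  · obtain ⟨χ, hχ⟩ := exists_pontryaginDual_ne_one hx
    have : Additive.ofMul χ ∈ orbitAnnihilator Γ x := hE ▸ AddSubgroup.mem_top _
    exact hχ (this 1 Γ.one_mem)
  · have hΔ : ∀ a : Additive (PontryaginDual K),
        FiniteOrbitMod (orbitAnnihilator Γ x) (Δ.subgroupOf Γ) a := fun a =>
      ⟨_, (finite_smul_char hcompact a.toMul).image Additive.ofMul, fun δ hδ =>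
        ⟨δ • a, ⟨_, ⟨δ, hδ, rfl⟩, rfl⟩, by rw [sub_self]; exact zero_mem _⟩⟩
    obtain ⟨a, haE, ha⟩ := exists_finiteOrbitMod hΔ
      (fun a b => habel a a.2 b b.2) smul_mem_orbitAnnihilator hE (finite_range α')
      (by
        rintro - ⟨i, rfl⟩ a
        exact DistalAut.exists_pow_sub_one_pow_eq_zero (g := α' i) (h i) a)
    rw [hgen'] at ha
    exact haE (mem_orbitAnnihilator_of_finiteOrbitMod hcl ha)

end ErgZd
end

section
/- Let K be a compact connected metrizable group and let α₁, …, α_n be pairwise commuting continuous automorphisms of K. Then each α_i is distal on K if and only if the group of automorphisms generated by α₁, …, α_n is distal on K. -/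
open MeasureTheory Topology Set

set_option linter.unusedVariables false

namespace ErgZd

variable {K : Type*}

section Auxiliary

open Filter
open scoped symmDiff ENNReal

instance {Γ X : Type*} [Group Γ] [TopologicalSpace X] [MulAction Γ X] [ContinuousConstSMul Γ X]
    (G : Subgroup Γ) : ContinuousConstSMul G X :=
  ⟨fun g => continuous_const_smul (g : Γ)⟩

section Distal

variable {Γ L : Type*} [Group Γ] [Group L] [TopologicalSpace L] [MulDistribMulAction Γ L]

variable (Γ L) in
/-- The action of `Γ` on `L` by automorphisms is distal. -/
def IsDistalAction : Prop :=
  ∀ x : L, (1 : L) ∈ closure (MulAction.orbit Γ x) → x = 1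

/-- The Ellis semigroup of an action: the pointwise closure of the set of translations. -/
def ellisSemigroup (Γ L : Type*) [Group Γ] [Group L] [TopologicalSpace L]
    [MulDistribMulAction Γ L] : Set (L → L) :=
  closure (range fun (g : Γ) (x : L) => g • x)

lemma apply_mem_closure_orbit {p : L → L} (hp : p ∈ ellisSemigroup Γ L) (x : L) :
    p x ∈ closure (MulAction.orbit Γ x) :=
  map_mem_closure (f := fun q : L → L => q x) (continuous_apply x) hp
    (by rintro _ ⟨g, rfl⟩; exact ⟨g, rfl⟩)

lemma isCompact_ellisSemigroup [CompactSpace L] : IsCompact (ellisSemigroup Γ L) :=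
  isClosed_closure.isCompact

lemma map_mul_of_mem_ellisSemigroup [IsTopologicalGroup L] [T2Space L] {p : L → L}
    (hp : p ∈ ellisSemigroup Γ L) (x y : L) : p (x * y) = p x * p y := by
  have hcl : IsClosed {q : L → L | q (x * y) = q x * q y} :=
    isClosed_eq (continuous_apply _) ((continuous_apply x).mul (continuous_apply y))
  refine closure_minimal ?_ hcl hp
  rintro _ ⟨g, rfl⟩
  exact smul_mul' g x y

lemma comp_mem_ellisSemigroup [ContinuousConstSMul Γ L] {p q : L → L}
    (hp : p ∈ ellisSemigroup Γ L) (hq : q ∈ ellisSemigroup Γ L) :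
    p ∘ q ∈ ellisSemigroup Γ L := by
  have hsmul (g : Γ) : (fun x => g • q x) ∈ ellisSemigroup Γ L := by
    refine map_mem_closure (f := fun (r : L → L) x => g • r x) (by fun_prop) hq ?_
    rintro _ ⟨h, rfl⟩
    exact ⟨g * h, funext fun x => mul_smul g h x⟩
  have hcl : IsClosed (ellisSemigroup Γ L) := isClosed_closure
  exact closure_minimal (by rintro _ ⟨g, rfl⟩; exact hsmul g)
    (hcl.preimage (f := fun r : L → L => r ∘ q) (by fun_prop)) hp

/-- In a distal action every element of the Ellis semigroup has a left inverse in it. -/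
lemma IsDistalAction.exists_leftInverse [IsTopologicalGroup L] [CompactSpace L] [T2Space L]
    [ContinuousConstSMul Γ L] (hd : IsDistalAction Γ L) {p : L → L}
    (hp : p ∈ ellisSemigroup Γ L) :
    ∃ q ∈ ellisSemigroup Γ L, ∀ x, q (p x) = x := by
  let _ : TopologicalSpace (Function.End L) := Pi.topologicalSpace
  have : T2Space (Function.End L) := inferInstanceAs (T2Space (L → L))
  obtain ⟨_, ⟨q, hq, rfl⟩, hqq⟩ := exists_idempotent_in_compact_subsemigroup (M := Function.End L)
    (fun r => continuous_pi fun x => continuous_apply (r x))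
    ((fun q : L → L => q ∘ p) '' ellisSemigroup Γ L)
    ⟨_, p, hp, rfl⟩ (isCompact_ellisSemigroup.image (by fun_prop)) (by
      rintro _ ⟨q, hq, rfl⟩ _ ⟨r, hr, rfl⟩
      exact ⟨(q ∘ p) ∘ r,
        comp_mem_ellisSemigroup (comp_mem_ellisSemigroup hq hp) hr, rfl⟩)
  refine ⟨q, hq, fun x => ?_⟩
  have hu := comp_mem_ellisSemigroup hq hp
  have hidem : (q ∘ p) ((q ∘ p) x) = (q ∘ p) x := congrFun hqq x
  set u := q ∘ p
  have hmul := map_mul_of_mem_ellisSemigroup hu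
  have hone : u 1 = 1 := by simpa using hmul 1 1
  have hker : u (x⁻¹ * u x) = 1 := by
    rw [hmul, hidem, ← hmul, inv_mul_cancel, hone]
  have := hd (x⁻¹ * u x) (hker ▸ apply_mem_closure_orbit hu _)
  exact (inv_mul_eq_one.mp this).symm

/-- A factor of a distal action is distal at the image of `1`. -/
lemma IsDistalAction.eq_of_mem_closure [IsTopologicalGroup L] [CompactSpace L] [T2Space L]
    [ContinuousConstSMul Γ L] (hd : IsDistalAction Γ L) {X : Type*} [TopologicalSpace X]
    [T2Space X] {φ : L → X} (hφ : Continuous φ) {z : L}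
    (hz : (fun _ => φ 1) ∈ closure (range fun (g h : Γ) => φ (h • g • z))) : φ z = φ 1 := by
  have hcont : Continuous fun (p : L → L) (h : Γ) => φ (h • p z) := by fun_prop
  have hcl := ((isCompact_ellisSemigroup (Γ := Γ) (L := L)).image hcont).isClosed
  obtain ⟨p, hp, hpz⟩ := closure_minimal (by
    rintro _ ⟨g, rfl⟩
    exact ⟨_, subset_closure ⟨g, rfl⟩, rfl⟩) hcl hz
  obtain ⟨q, hq, hqp⟩ := hd.exists_leftInverse hp
  have hcl' : IsClosed {r : L → L | φ (r (p z)) = φ 1} :=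
    isClosed_eq (by fun_prop) continuous_const
  have := closure_minimal (by rintro _ ⟨g, rfl⟩; exact congrFun hpz g) hcl' hq
  simpa [hqp] using this

end Distal

section Haar

variable {L : Type*} [Group L] [MeasurableSpace L] (μ : Measure L)

/-- The measure of the symmetric difference of `A` and its translate by `y⁻¹`. -/
def translateDist (A : Set L) (y : L) : ℝ≥0∞ := μ (((y * ·) ⁻¹' A) ∆ A)

@[simp] lemma translateDist_one (A : Set L) : translateDist μ A 1 = 0 := by
  simp [translateDist]

lemma translateDist_eq_zero_iff {A : Set L} {y : L} :
    translateDist μ A y = 0 ↔ ((y * ·) ⁻¹' A : Set L) =ᵐ[μ] A :=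
  measure_symmDiff_eq_zero_iff

variable [TopologicalSpace L]

/-- If all invariant open sets are null or conull, then almost every orbit is dense
in every second countable factor. -/
lemma ae_mem_closure_image_orbit [μ.IsOpenPosMeasure] {Γ : Type*} [Group Γ]
    [MulDistribMulAction Γ L] [ContinuousConstSMul Γ L] {X : Type*} [TopologicalSpace X]
    [SecondCountableTopology X] {Φ : L → X} (hΦ : Continuous Φ)
    (herg : ∀ A : Set L, IsOpen A → (∀ g : Γ, (g • ·) ⁻¹' A = A) → EventuallyConst A (ae μ))
    (y : L) : ∀ᵐ z ∂μ, Φ y ∈ closure (Φ '' MulAction.orbit Γ z) := by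
  have hb := TopologicalSpace.isBasis_countableBasis X
  have hae : ∀ᵐ z ∂μ, ∀ U ∈ TopologicalSpace.countableBasis X, Φ y ∈ U →
      ∃ g : Γ, Φ (g • z) ∈ U := by
    rw [ae_ball_iff (TopologicalSpace.countable_countableBasis X)]
    intro U hU
    by_cases hy : Φ y ∈ U
    swap
    · exact .of_forall fun _ h => (hy h).elim
    have hUo : IsOpen (Φ ⁻¹' U) := (hb.isOpen hU).preimage hΦ
    let A : Set L := ⋃ g : Γ, (g • ·) ⁻¹' (Φ ⁻¹' U)
    have hAo : IsOpen A := isOpen_iUnion fun g => hUo.preimage (continuous_const_smul g)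
    have hAinv (g : Γ) : (g • ·) ⁻¹' A = A := by
      ext z
      simp only [A, mem_preimage, mem_iUnion, ← mul_smul]
      exact (Equiv.mulRight g).exists_congr_left.trans (by simp)
    have hyA : y ∈ A := mem_iUnion.mpr ⟨1, by simpa using hy⟩
    rcases eventuallyConst_set.mp (herg A hAo hAinv) with h | h
    · filter_upwards [h] with z hz _
      simpa [A] using hz
    · exact (hAo.measure_ne_zero μ ⟨y, hyA⟩ (by simpa [ae_iff] using h)).elim
  filter_upwards [hae] with z hz
  refine hb.mem_closure_iff.mpr fun U hU hyU => ?_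
  obtain ⟨g, hg⟩ := hz U hU hyU
  exact ⟨_, hg, _, ⟨g, rfl⟩, rfl⟩

/-- A distal action on a nontrivial group has a nontrivial invariant open set. -/
lemma IsDistalAction.exists_isOpen_not_eventuallyConst [μ.IsOpenPosMeasure]
    {Γ : Type*} [Group Γ] [MulDistribMulAction Γ L] [ContinuousConstSMul Γ L]
    [T2Space L] [SecondCountableTopology L] (hd : IsDistalAction Γ L) {x : L}
    (hx : x ≠ 1) :
    ∃ A : Set L, IsOpen A ∧ (∀ g : Γ, (g • ·) ⁻¹' A = A) ∧ ¬ EventuallyConst A (ae μ) := by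
  by_contra! h
  have hae : (id : L → L) =ᵐ[μ] fun _ => 1 := by
    filter_upwards [ae_mem_closure_image_orbit μ continuous_id h 1] with z hz
    exact hd z (by simpa using hz)
  exact hx (congrFun ((continuous_id.ae_eq_iff_eq μ continuous_const).mp hae) x)

variable [IsTopologicalGroup L] [BorelSpace L] [μ.IsHaarMeasure]

/-- The subgroup of those elements that preserve `A` up to a null set. -/
def aeStabilizer (A : Set L) : Subgroup L where
  carrier := {y | ((y * ·) ⁻¹' A : Set L) =ᵐ[μ] A}
  one_mem' := by simpa using ae_eq_refl (μ := μ) (A : L → Prop)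
  mul_mem' {a b} ha hb := by
    have := (measurePreserving_mul_left μ b).quasiMeasurePreserving.preimage_ae_eq ha
    have h : ((a * b * ·) ⁻¹' A : Set L) = (b * ·) ⁻¹' ((a * ·) ⁻¹' A) := by
      ext; simp [mul_assoc]
    change ((a * b * ·) ⁻¹' A : Set L) =ᵐ[μ] A
    rw [h]
    exact this.trans hb
  inv_mem' {a} ha := by
    have := (measurePreserving_mul_left μ a⁻¹).quasiMeasurePreserving.preimage_ae_eq ha
    have h : ((a⁻¹ * ·) ⁻¹' ((a * ·) ⁻¹' A) : Set L) = A := by ext; simp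
    exact (h ▸ this).symm

lemma mem_aeStabilizer_iff {A : Set L} {y : L} :
    y ∈ aeStabilizer μ A ↔ translateDist μ A y = 0 :=
  (translateDist_eq_zero_iff μ).symm

variable [CompactSpace L]

lemma continuous_translateDist {A : Set L} (hA : MeasurableSet A) :
    Continuous (translateDist μ A) := by
  refine continuous_iff_continuousAt.mpr fun y => ?_
  let f : C(L × L, L) := ⟨fun p => p.1 * p.2, continuous_mul⟩
  have key := tendsto_measure_symmDiff_preimage_nhds_zero (μ := μ) (ν := μ)
    (f.curry.continuous.tendsto y) (.of_forall fun z => measurePreserving_mul_left μ z)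
    (measurePreserving_mul_left μ y) hA.nullMeasurableSet (measure_ne_top μ A)
  rw [ENNReal.tendsto_nhds_zero] at key
  refine (ENNReal.tendsto_nhds (measure_ne_top μ _)).mpr fun ε hε => ?_
  filter_upwards [key ε hε] with z hz
  replace hz : μ (((z * ·) ⁻¹' A) ∆ ((y * ·) ⁻¹' A)) ≤ ε := hz
  constructor
  · rw [tsub_le_iff_left]
    refine (measure_symmDiff_le _ ((z * ·) ⁻¹' A) _).trans ?_
    rw [symmDiff_comm]
    exact add_le_add_left hz _
  · rw [add_comm]
    exact (measure_symmDiff_le _ ((y * ·) ⁻¹' A) _).trans (add_le_add_left hz _)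

lemma eventuallyConst_of_translateDist_eq_zero [SecondCountableTopology L] {A : Set L}
    (hA : MeasurableSet A)
    (h : ∀ y, translateDist μ A y = 0) : EventuallyConst A (ae μ) :=
  aeconst_of_forall_preimage_smul_ae_eq L hA.nullMeasurableSet fun y =>
    (translateDist_eq_zero_iff μ).mp (h y)

lemma isClosed_aeStabilizer {A : Set L} (hA : MeasurableSet A) :
    IsClosed (aeStabilizer μ A : Set L) := by
  have : (aeStabilizer μ A : Set L) = translateDist μ A ⁻¹' {0} := by
    ext y; exact mem_aeStabilizer_iff μ
  rw [this]
  exact isClosed_singleton.preimage (continuous_translateDist μ hA)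

variable {Γ : Type*} [Group Γ] [MulDistribMulAction Γ L] [ContinuousConstSMul Γ L]

lemma translateDist_smul {A : Set L} (hA : MeasurableSet A) {g : Γ}
    (hg : (g • ·) ⁻¹' A = A) (y : L) : translateDist μ A (g • y) = translateDist μ A y := by
  have hmp : MeasurePreserving (g • · : L → L) μ μ :=
    MonoidHom.measurePreserving (f := MulDistribMulAction.toMonoidHom L g)
      (continuous_const_smul g) (MulAction.surjective g) rfl
  have hmeas : MeasurableSet (((g • y * ·) ⁻¹' A) ∆ A) :=
    (measurable_const_mul _ hA).symmDiff hA
  rw [translateDist, ← hmp.measure_preimage hmeas.nullMeasurableSet, preimage_symmDiff, hg,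
    translateDist]
  congr 2
  ext x
  have hmem (w : L) : g • w ∈ A ↔ w ∈ A := Set.ext_iff.mp hg w
  simp [← smul_mul', hmem]

/-- If `1` is in the closure of the orbit of an element that topologically generates `L` as a
`Γ`-group, then the action is ergodic. -/
lemma eventuallyConst_of_generating [SecondCountableTopology L] {x : L}
    (hx : (1 : L) ∈ closure (MulAction.orbit Γ x))
    (hgen : ∀ S : Subgroup L, IsClosed (S : Set L) → (∀ g : Γ, ∀ y ∈ S, g • y ∈ S) →
      x ∈ S → S = ⊤)
    {A : Set L} (hA : MeasurableSet A) (hinv : ∀ g : Γ, (g • ·) ⁻¹' A = A) :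
    EventuallyConst A (ae μ) := by
  have hstab : aeStabilizer μ A = ⊤ := by
    refine hgen _ (isClosed_aeStabilizer μ hA) (fun g y hy => ?_) ?_
    · rwa [mem_aeStabilizer_iff, translateDist_smul μ hA (hinv g), ← mem_aeStabilizer_iff]
    · have hcl : IsClosed {y | translateDist μ A y = translateDist μ A x} :=
        isClosed_eq (continuous_translateDist μ hA) continuous_const
      have h1 := closure_minimal (by
        rintro _ ⟨g, rfl⟩
        exact translateDist_smul μ hA (hinv g) x) hcl hx
      rw [mem_aeStabilizer_iff]
      simpa using h1.symm
  exact eventuallyConst_of_translateDist_eq_zero μ hA fun y =>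
    (mem_aeStabilizer_iff μ).mp (hstab ▸ Subgroup.mem_top y)

end Haar

section Product

variable {Γ L : Type*} [Group Γ] [Group L] [TopologicalSpace L] [IsTopologicalGroup L]
  [CompactSpace L] [T2Space L] [SecondCountableTopology L] [MulDistribMulAction Γ L]
  [ContinuousConstSMul Γ L]

lemma eq_one_of_generating {G H : Subgroup Γ} [Countable H]
    (hcomm : ∀ g ∈ G, ∀ h ∈ H, g * h = h * g) (hGH : ∀ γ : Γ, ∃ h ∈ H, ∃ g ∈ G, γ = g * h)
    (hG : IsDistalAction G L) (hH : IsDistalAction H L) {x : L}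
    (hx : (1 : L) ∈ closure (MulAction.orbit Γ x))
    (hgen : ∀ S : Subgroup L, IsClosed (S : Set L) → (∀ g : Γ, ∀ y ∈ S, g • y ∈ S) →
      x ∈ S → S = ⊤) : x = 1 := by
  by_contra hne
  borelize L
  let μ : Measure L := Measure.haar
  obtain ⟨A, hAo, hAinv, hA⟩ := hG.exists_isOpen_not_eventuallyConst μ hne
  have hAm := hAo.measurableSet
  have hφ := continuous_translateDist μ hAm
  have hφG (g : G) (z : L) : translateDist μ A (g • z) = translateDist μ A z :=
    translateDist_smul μ hAm (hAinv g) z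
  let Φ : L → H → ℝ≥0∞ := fun z h => translateDist μ A (h • z)
  have hΦ : Continuous Φ := by fun_prop
  have hae : translateDist μ A =ᵐ[μ] fun _ => 0 := by
    filter_upwards [ae_mem_closure_image_orbit (Γ := Γ) μ hΦ
      (fun B hB hinv => eventuallyConst_of_generating μ hx hgen hB.measurableSet hinv) 1] with z hz
    rw [← translateDist_one μ A]
    refine hH.eq_of_mem_closure hφ ?_
    have h1 : Φ 1 = fun _ => translateDist μ A 1 := by ext h; simp [Φ]
    rw [← h1]
    refine closure_mono ?_ hz
    rintro _ ⟨_, ⟨γ, rfl⟩, rfl⟩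
    obtain ⟨h, hh, g, hg, rfl⟩ := hGH γ
    refine ⟨⟨h, hh⟩, funext fun k => ?_⟩
    have : (k : Γ) • (g * h) • z = g • (k : Γ) • h • z := by
      simp only [← mul_smul]
      rw [← mul_assoc, ← hcomm g hg k k.2, mul_assoc]
    exact (hφG ⟨g, hg⟩ _).symm.trans (congrArg (translateDist μ A) this.symm)
  have hzero := (hφ.ae_eq_iff_eq μ continuous_const).mp hae
  exact hA (eventuallyConst_of_translateDist_eq_zero μ hAm (congrFun hzero))

/-- An action of a product of two commuting subgroups acting distally is distal. -/
theorem isDistalAction_of_commuting {G H : Subgroup Γ} [Countable H]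
    (hcomm : ∀ g ∈ G, ∀ h ∈ H, g * h = h * g) (hGH : ∀ γ : Γ, ∃ h ∈ H, ∃ g ∈ G, γ = g * h)
    (hG : IsDistalAction G L) (hH : IsDistalAction H L) : IsDistalAction Γ L := by
  intro x hx
  let M : Subgroup L :=
    sInf {S | IsClosed (S : Set L) ∧ (∀ g : Γ, ∀ y ∈ S, g • y ∈ S) ∧ x ∈ S}
  have hMcl : IsClosed (M : Set L) := by
    rw [Subgroup.coe_sInf]
    exact isClosed_biInter fun S hS => hS.1
  have hMinv (g : Γ) (y : L) (hy : y ∈ M) : g • y ∈ M :=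
    Subgroup.mem_sInf.mpr fun S hS => hS.2.1 g y (Subgroup.mem_sInf.mp hy S hS)
  have hxM : x ∈ M := Subgroup.mem_sInf.mpr fun S hS => hS.2.2
  have : CompactSpace M := isCompact_iff_compactSpace.mp hMcl.isCompact
  let _ : MulDistribMulAction Γ M :=
    { smul := fun g y => ⟨g • (y : L), hMinv g y y.2⟩
      one_smul := fun y => Subtype.ext (one_smul Γ (y : L))
      mul_smul := fun g h y => Subtype.ext (mul_smul g h (y : L))
      smul_mul := fun g y z => Subtype.ext (smul_mul' g (y : L) z)
      smul_one := fun g => Subtype.ext (smul_one g) }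
  have : ContinuousConstSMul Γ M :=
    ⟨fun g => ((continuous_const_smul g).comp continuous_subtype_val).subtype_mk _⟩
  have : SecondCountableTopology M := inferInstanceAs (SecondCountableTopology (M : Set L))
  have hrestrict (N : Subgroup Γ) (hN : IsDistalAction N L) : IsDistalAction N M := by
    intro y hy
    refine Subtype.ext (hN y (map_mem_closure (f := ((↑) : M → L)) continuous_subtype_val hy ?_))
    rintro _ ⟨g, rfl⟩
    exact ⟨g, rfl⟩
  have hx' : (1 : M) ∈ closure (MulAction.orbit Γ (⟨x, hxM⟩ : M)) := by
    rw [closure_subtype, OneMemClass.coe_one]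
    convert hx using 2
    ext y
    constructor
    · rintro ⟨_, ⟨g, rfl⟩, rfl⟩
      exact ⟨g, rfl⟩
    · rintro ⟨g, rfl⟩
      exact ⟨_, ⟨g, rfl⟩, rfl⟩
  have := eq_one_of_generating hcomm hGH (hrestrict G hG) (hrestrict H hH) hx' (by
    intro S hS hSinv hxS
    refine (Subgroup.eq_top_iff' S).mpr fun y => ?_
    have hle : M ≤ S.map M.subtype := sInf_le ⟨?_, ?_, ⟨_, hxS, rfl⟩⟩
    · obtain ⟨y', hy', h⟩ := hle y.2
      exact (Subtype.ext h : y' = y) ▸ hy'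
    · exact hMcl.isClosedEmbedding_subtypeVal.isClosedMap _ hS
    · rintro g _ ⟨z, hz, rfl⟩
      exact ⟨g • z, hSinv g z hz, rfl⟩)
  exact congrArg Subtype.val this

end Product

section ContAut

variable {K : Type*} [Group K] [TopologicalSpace K]

instance : ContinuousConstSMul (ContAut K) K := ⟨fun g => ContAut.continuous g⟩

lemma distalSet_coe_iff (G : Subgroup (ContAut K)) :
    DistalSet (G : Set (ContAut K)) ↔ IsDistalAction G K := by
  have horb (x : K) : (fun α : ContAut K => (α : MulAut K) x) '' (G : Set (ContAut K)) =
      MulAction.orbit G x := by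
    ext y
    exact ⟨fun ⟨g, hg, h⟩ => ⟨⟨g, hg⟩, h⟩, fun ⟨g, h⟩ => ⟨g, g.2, h⟩⟩
  simp only [DistalSet, IsDistalAction, horb]
  exact forall_congr' fun x => not_imp_not

lemma distalAut_iff (a : ContAut K) :
    DistalAut a ↔ DistalSet (Subgroup.zpowers a : Set (ContAut K)) := by
  rw [DistalAut, Subgroup.coe_zpowers]

lemma DistalSet.mono {S T : Set (ContAut K)} (hST : S ⊆ T) (hT : DistalSet T) : DistalSet S :=
  fun x hx h => hT x hx (closure_mono (image_mono hST) h)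

variable [IsTopologicalGroup K] [CompactSpace K] [TopologicalSpace.MetrizableSpace K]

lemma DistalSet.closure_insert {a : ContAut K} {S : Set (ContAut K)}
    (hcomm : ∀ b ∈ S, a * b = b * a) (ha : DistalAut a)
    (hS : DistalSet (Subgroup.closure S : Set (ContAut K))) :
    DistalSet (Subgroup.closure (insert a S) : Set (ContAut K)) := by
  rw [distalAut_iff, distalSet_coe_iff] at ha
  rw [distalSet_coe_iff] at hS ⊢
  set Γ := Subgroup.closure (insert a S)
  have hcomm' : ∀ g ∈ Subgroup.closure S, ∀ h ∈ Subgroup.zpowers a, g * h = h * g := by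
    rintro g hg _ ⟨k, rfl⟩
    have : Commute g a := by
      induction hg using Subgroup.closure_induction with
      | mem b hb => exact (hcomm b hb).symm
      | one => exact Commute.one_left a
      | mul b c _ _ hb hc => exact hb.mul_left hc
      | inv b _ hb => exact hb.inv_left
    exact this.zpow_right k
  have hle : Subgroup.closure S ≤ Γ := Subgroup.closure_mono (subset_insert a S)
  have hale : Subgroup.zpowers a ≤ Γ :=
    (Subgroup.zpowers_le).mpr (Subgroup.subset_closure (mem_insert a S))
  have hprod : ∀ γ ∈ Γ, ∃ h ∈ Subgroup.zpowers a, ∃ g ∈ Subgroup.closure S, γ = g * h := by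
    intro γ hγ
    induction hγ using Subgroup.closure_induction with
    | mem b hb =>
      rcases hb with rfl | hb
      · exact ⟨b, Subgroup.mem_zpowers b, 1, one_mem _, (one_mul b).symm⟩
      · exact ⟨1, one_mem _, b, Subgroup.subset_closure hb, (mul_one b).symm⟩
    | one => exact ⟨1, one_mem _, 1, one_mem _, (mul_one 1).symm⟩
    | mul _ _ _ _ hb hc =>
      obtain ⟨h, hh, g, hg, rfl⟩ := hb
      obtain ⟨h', hh', g', hg', rfl⟩ := hc
      refine ⟨h * h', mul_mem hh hh', g * g', mul_mem hg hg', ?_⟩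
      rw [mul_assoc, ← mul_assoc h, ← hcomm' g' hg' h hh]
      simp only [mul_assoc]
    | inv _ _ hb =>
      obtain ⟨h, hh, g, hg, rfl⟩ := hb
      refine ⟨h⁻¹, inv_mem hh, g⁻¹, inv_mem hg, ?_⟩
      rw [hcomm' g hg h hh, mul_inv_rev]
  have htrans (N : Subgroup (ContAut K)) (hN : IsDistalAction N K) :
      IsDistalAction (N.subgroupOf Γ) K := by
    refine fun x hx => hN x (closure_mono ?_ hx)
    rintro _ ⟨g, rfl⟩
    exact ⟨⟨g, g.2⟩, rfl⟩
  let _ : MetricSpace K := TopologicalSpace.metrizableSpaceMetric K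
  have : Countable ((Subgroup.zpowers a).subgroupOf Γ) :=
    (Subgroup.subgroupOfEquivOfLe hale).toEquiv.countable_iff.mpr inferInstance
  refine isDistalAction_of_commuting (G := (Subgroup.closure S).subgroupOf Γ)
    (H := (Subgroup.zpowers a).subgroupOf Γ)
    (fun g hg h hh => Subtype.ext (hcomm' g hg h hh)) (fun γ => ?_) (htrans _ hS) (htrans _ ha)
  obtain ⟨h, hh, g, hg, e⟩ := hprod γ γ.2
  exact ⟨⟨h, hale hh⟩, hh, ⟨g, hle hg⟩, hg, Subtype.ext e⟩

end ContAut

end Auxiliary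

/-- Lemma 3.3. Let `α 1, …, α n` be pairwise commuting continuous
automorphisms of a compact connected metrizable group `K`. Then each `α i` is distal on
`K` if and only if the group generated by `α 1, …, α n` is distal on `K`. -/
theorem statement7 {K : Type*} [Group K] [TopologicalSpace K] [IsTopologicalGroup K]
    [CompactSpace K] [TopologicalSpace.MetrizableSpace K] [ConnectedSpace K]
    {n : ℕ} (α : Fin n → ↥(ContAut K))
    (hcomm : ∀ i j, α i * α j = α j * α i) :
    (∀ i, DistalAut (α i)) ↔
      DistalSet ((Subgroup.closure (Set.range α) : Subgroup ↥(ContAut K)) :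
        Set ↥(ContAut K)) := by
  constructor
  · intro h
    suffices hs : ∀ s : Finset (Fin n),
        DistalSet (Subgroup.closure (α '' s) : Set (ContAut K)) by
      simpa using hs Finset.univ
    intro s
    induction s using Finset.induction_on with
    | empty =>
      intro x hx
      simpa using hx.symm
    | insert a s _ ih =>
      rw [Finset.coe_insert, image_insert_eq]
      refine ih.closure_insert ?_ (h a)
      rintro _ ⟨j, _, rfl⟩
      exact hcomm a j
  · intro h i
    rw [distalAut_iff]
    exact h.mono (Subgroup.zpowers_le.mpr (Subgroup.subset_closure (mem_range_self i)))

end ErgZd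
end

section
/- Let K be a compact metrizable group and let α₁, …, α_n be pairwise commuting continuous automorphisms of K. Then each α_i is distal on K if and only if the group of automorphisms generated by α₁, …, α_n is distal on K. -/
open MeasureTheory Topology Set

set_option linter.unusedVariables false

namespace ErgZd

variable {K : Type*}

open Filter
open scoped symmDiff Pointwise

section Orbits

variable [Group K] [TopologicalSpace K]

/-- The automorphisms under which a function on the group is invariant. -/
def invariants {X : Type*} (f : K → X) : Subgroup ↥(ContAut K) where
  carrier := {γ | ∀ x, f ((γ : MulAut K) x) = f x}
  one_mem' := fun _ => rfl
  mul_mem' := fun {a b} ha hb x => (ha ((b : MulAut K) x)).trans (hb x)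
  inv_mem' := fun {a} ha x => by
    have h := ha ((a : MulAut K).symm x)
    rw [MulEquiv.apply_symm_apply] at h
    exact h.symm

lemma zpow_apply_mem {α : ↥(ContAut K)} {N : Subgroup K}
    (hN : ∀ x, (α : MulAut K) x ∈ N ↔ x ∈ N) (k : ℤ) (x : K) :
    ((α ^ k : ↥(ContAut K)) : MulAut K) x ∈ N ↔ x ∈ N := by
  have h : α ∈ invariants (fun x => x ∈ N) := fun x => propext (hN x)
  exact iff_of_eq ((invariants (fun x => x ∈ N)).zpow_mem h k x)

/-- If the orbit closure of a point under a distal automorphism meets a closed invariant subgroup,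
then the point lies in that subgroup. -/
lemma DistalAut.mem_of_mem_closure_orbit [IsTopologicalGroup K] [CompactSpace K] [T2Space K]
    {α : ↥(ContAut K)} (hα : DistalAut α) {N : Subgroup K} (hNc : IsClosed (N : Set K))
    (hN : ∀ x, (α : MulAut K) x ∈ N ↔ x ∈ N) {x z : K} (hz : z ∈ N)
    (hzx : z ∈ closure (range fun k : ℤ => ((α ^ k : ↥(ContAut K)) : MulAut K) x)) : x ∈ N := by
  let orb : ℤ → K → K := fun k => ((α ^ k : ↥(ContAut K)) : MulAut K)
  let E : Set (K → K) := closure (range orb)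
  have hEc : IsCompact E := isClosed_closure.isCompact
  have hEhom : ∀ p ∈ E, ∀ a b, p (a * b) = p a * p b := by
    intro p hp a b
    have hcl : IsClosed {p : K → K | p (a * b) = p a * p b} :=
      isClosed_eq (by fun_prop) (by fun_prop)
    refine closure_minimal ?_ hcl hp
    rintro _ ⟨k, rfl⟩
    exact map_mul _ a b
  have hEN : ∀ p ∈ E, ∀ a ∈ N, p a ∈ N := by
    intro p hp a ha
    refine closure_minimal (t := {p : K → K | p a ∈ N}) ?_ (hNc.preimage (continuous_apply a)) hp
    rintro _ ⟨k, rfl⟩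
    exact (zpow_apply_mem hN k a).2 ha
  have hEmul : ∀ p ∈ E, ∀ q ∈ E, p ∘ q ∈ E := by
    intro p hp q hq
    have hright : Continuous fun r : K → K => r ∘ q :=
      continuous_pi fun a => continuous_apply (q a)
    refine closure_minimal (t := {r : K → K | r ∘ q ∈ E}) ?_ (isClosed_closure.preimage hright) hp
    rintro _ ⟨k, rfl⟩
    have hleft : Continuous fun r : K → K => orb k ∘ r :=
      continuous_pi fun a => (ContAut.continuous (α ^ k)).comp (continuous_apply a)
    refine closure_minimal (t := {r : K → K | orb k ∘ r ∈ E}) ?_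
      (isClosed_closure.preimage hleft) hq
    rintro _ ⟨l, rfl⟩
    refine subset_closure ⟨k + l, ?_⟩
    funext a
    change ((α ^ (k + l) : ↥(ContAut K)) : MulAut K) a = _
    rw [zpow_add]
    rfl
  have hEval : ∀ a, (fun p : K → K => p a) '' E = closure (range fun k => orb k a) := by
    intro a
    rw [image_closure_of_isCompact hEc (continuous_apply a).continuousOn, ← range_comp]
    rfl
  obtain ⟨p, hp, hpx⟩ : z ∈ (fun p : K → K => p x) '' E := by rw [hEval]; exact hzx
  let sg : Semigroup (K → K) := { mul := fun p q => p ∘ q, mul_assoc := fun _ _ _ => rfl }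
  obtain ⟨u, ⟨huE, hux⟩, huu⟩ := @exists_idempotent_in_compact_subsemigroup (K → K) sg _ _
    (fun q => continuous_pi fun a => continuous_apply (q a)) (E ∩ {p | p x ∈ N})
    ⟨p, hp, by change p x ∈ N; rw [show p x = z from hpx]; exact hz⟩
    (hEc.inter_right (hNc.preimage (continuous_apply x)))
    (fun p hp q hq => ⟨hEmul p hp.1 q hq.1, hEN p hp.1 _ hq.2⟩)
  have huux : u (u x) = u x := congrFun huu x
  have hfix : u (u x * x⁻¹) = 1 := by
    have h := hEhom u huE (u x * x⁻¹) x
    rw [inv_mul_cancel_right, huux] at h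
    exact (mul_eq_right.1 h.symm)
  have hone : u x * x⁻¹ = 1 := by
    by_contra hne
    refine hα _ hne ?_
    rw [← range_comp]
    have : (1 : K) ∈ (fun p : K → K => p (u x * x⁻¹)) '' E := ⟨u, huE, hfix⟩
    rw [hEval] at this
    exact this
  rw [mul_inv_eq_one] at hone
  rw [← hone]
  exact hux

/-- A distal automorphism is not topologically transitive modulo a proper closed invariant
subgroup. -/
lemma DistalAut.exists_invariant_open [IsTopologicalGroup K] [CompactSpace K] [T2Space K]
    [SecondCountableTopology K]
    {α : ↥(ContAut K)} (hα : DistalAut α) {N : Subgroup K} (hNc : IsClosed (N : Set K))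
    (hN : ∀ x, (α : MulAut K) x ∈ N ↔ x ∈ N) (hNt : N ≠ ⊤) :
    ∃ U : Set K, IsOpen U ∧ U.Nonempty ∧ ¬ Dense U ∧ (∀ x, (α : MulAut K) x ∈ U ↔ x ∈ U) ∧
      ∀ x ∈ U, ∀ n ∈ N, x * n ∈ U := by
  by_contra! hcon
  let V : Set K → Set K := fun B => ⋃ k : ℤ, ⇑((α ^ k : ↥(ContAut K)) : MulAut K) ⁻¹' (B * N)
  have hVo : ∀ B, IsOpen B → IsOpen (V B) := fun B hB =>
    isOpen_iUnion fun k => (hB.mul_right).preimage (ContAut.continuous (α ^ k))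
  have hVd : ∀ B, IsOpen B → B.Nonempty → Dense (V B) := by
    intro B hB ⟨b, hb⟩
    by_contra hd
    have hne : (V B).Nonempty :=
      ⟨b, mem_iUnion.2 ⟨0, by
        change b ∈ B * (N : Set K)
        exact ⟨b, hb, 1, N.one_mem, mul_one b⟩⟩⟩
    have hinv : ∀ x, (α : MulAut K) x ∈ V B ↔ x ∈ V B := by
      intro x
      simp only [V, mem_iUnion, mem_preimage]
      constructor
      · rintro ⟨k, hk⟩
        refine ⟨k + 1, ?_⟩
        rw [zpow_add_one]
        exact hk
      · rintro ⟨k, hk⟩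
        refine ⟨k - 1, ?_⟩
        rw [← sub_add_cancel k 1, zpow_add_one] at hk
        exact hk
    obtain ⟨x, hx, m, hm, hxm⟩ := hcon (V B) (hVo B hB) hne hd hinv
    apply hxm
    obtain ⟨k, c, hc, m', hm', hk⟩ := mem_iUnion.1 hx
    refine mem_iUnion.2 ⟨k, c, hc, m' * ((α ^ k : ↥(ContAut K)) : MulAut K) m,
      N.mul_mem hm' ((zpow_apply_mem hN k m).2 hm), ?_⟩
    have hk' : c * m' = ((α ^ k : ↥(ContAut K)) : MulAut K) x := hk
    simp only [map_mul, ← mul_assoc, hk']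
  have hdense : Dense (⋂ B ∈ TopologicalSpace.countableBasis K, V B) :=
    dense_biInter_of_isOpen
      (fun B hB => hVo B (TopologicalSpace.isOpen_of_mem_countableBasis hB))
      (TopologicalSpace.countable_countableBasis K)
      (fun B hB => hVd B (TopologicalSpace.isOpen_of_mem_countableBasis hB)
        (TopologicalSpace.nonempty_of_mem_countableBasis hB))
  obtain ⟨x, hx⟩ := hdense.nonempty
  let O : Set K := closure (range fun k : ℤ => ((α ^ k : ↥(ContAut K)) : MulAut K) x)
  have hON : IsClosed (O * (N : Set K)) :=
    (isClosed_closure.isCompact.mul hNc.isCompact).isClosed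
  have hall : ∀ y, y ∈ O * (N : Set K) := by
    intro y
    by_contra hy
    obtain ⟨B, hB, hyB, hBs⟩ :=
      (TopologicalSpace.isBasis_countableBasis K).exists_subset_of_mem_open
        (show y ∈ (O * (N : Set K))ᶜ from hy) hON.isOpen_compl
    obtain ⟨k, b, hb, m, hm, hk⟩ := mem_iUnion.1 (mem_iInter₂.1 hx B hB)
    have hk' : b * m = ((α ^ k : ↥(ContAut K)) : MulAut K) x := hk
    refine hBs hb ⟨_, subset_closure ⟨k, rfl⟩, m⁻¹, N.inv_mem hm, ?_⟩
    simp only [← hk', mul_inv_cancel_right]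
  have hxN : x ∈ N := by
    obtain ⟨z, hz, m, hm, hzm⟩ := hall 1
    have hzN : z ∈ N := by
      rw [show z = m⁻¹ from eq_inv_of_mul_eq_one_left hzm]
      exact N.inv_mem hm
    exact hα.mem_of_mem_closure_orbit hNc hN hzN hz
  have hOs : O ⊆ N := by
    refine closure_minimal ?_ hNc
    rintro _ ⟨k, rfl⟩
    exact (zpow_apply_mem hN k x).2 hxN
  refine hNt (eq_top_iff.2 fun y _ => ?_)
  obtain ⟨z, hz, m, hm, rfl⟩ := hall y
  exact N.mul_mem (hOs hz) hm

end Orbits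

section Seminorms

variable [Group K] [TopologicalSpace K]

lemma continuous_groupSeminorm [IsTopologicalGroup K] (p : GroupSeminorm K)
    (h : ∀ ε > 0, ∀ᶠ g in 𝓝 (1 : K), p g ≤ ε) : Continuous p := by
  rw [continuous_iff_continuousAt]
  intro x
  rw [ContinuousAt, Metric.tendsto_nhds]
  intro ε hε
  have hlim : Tendsto (fun y => y * x⁻¹) (𝓝 x) (𝓝 1) := by
    have : Continuous fun y => y * x⁻¹ := by fun_prop
    simpa using this.tendsto x
  filter_upwards [hlim.eventually (h (ε / 2) (half_pos hε))] with y hy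
  have h1 : p y ≤ p (y * x⁻¹) + p x := by simpa using map_mul_le_add p (y * x⁻¹) x
  have h2 : p x ≤ p (y * x⁻¹) + p y := by
    have h3 := map_mul_le_add p (y * x⁻¹)⁻¹ y
    rw [map_inv_eq_map] at h3
    simpa using h3
  rw [Real.dist_eq, abs_lt]
  constructor <;> linarith

/-- The supremum of a uniformly bounded family of group seminorms which is equicontinuous at the
identity is a continuous group seminorm. -/
lemma exists_groupSeminorm_iSup [IsTopologicalGroup K] {ι : Type*} [Nonempty ι]
    (p : ι → GroupSeminorm K) (C : ℝ) (hC : ∀ i x, p i x ≤ C)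
    (h : ∀ ε > 0, ∀ᶠ g in 𝓝 (1 : K), ∀ i, p i g ≤ ε) :
    ∃ q : GroupSeminorm K, Continuous q ∧ ∀ x, q x = ⨆ i, p i x := by
  have hb : ∀ x, BddAbove (range fun i => p i x) := fun x => ⟨C, by rintro _ ⟨i, rfl⟩; exact hC i x⟩
  let q : GroupSeminorm K :=
    { toFun := fun x => ⨆ i, p i x
      map_one' := by simp
      mul_le' := fun x y => ciSup_le fun i =>
        (map_mul_le_add (p i) x y).trans (add_le_add (le_ciSup (hb x) i) (le_ciSup (hb y) i))
      inv' := fun x => by simp }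
  refine ⟨q, continuous_groupSeminorm q fun ε hε => ?_, fun _ => rfl⟩
  filter_upwards [h ε hε] with g hg
  exact ciSup_le hg

/-- Continuous conjugation-invariant seminorms which are invariant under a set of automorphisms. -/
structure IsInvariantSeminorm (S : Set ↥(ContAut K)) (p : GroupSeminorm K) : Prop where
  continuous : Continuous p
  conj : ∀ k x, p (k * x * k⁻¹) = p x
  map_apply : ∀ γ ∈ S, ∀ x, p ((γ : MulAut K) x) = p x

/-- The measure of the symmetric difference of a measurable set and its translates, as a group
seminorm. -/
noncomputable def symmDiffSeminorm [IsTopologicalGroup K] [MeasurableSpace K] [BorelSpace K]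
    (μ : Measure K) [IsFiniteMeasure μ] [μ.IsMulLeftInvariant] {U : Set K}
    (hU : MeasurableSet U) : GroupSeminorm K where
  toFun g := μ.real (((fun x => g * x) ⁻¹' U) ∆ U)
  map_one' := by simp
  mul_le' g h := by
    have hm := (measurePreserving_mul_left μ h).measureReal_preimage
      (((measurable_const_mul g hU).symmDiff hU).nullMeasurableSet)
    have he : (fun x => h * x) ⁻¹' (((fun x => g * x) ⁻¹' U) ∆ U) =
        ((fun x => g * h * x) ⁻¹' U) ∆ ((fun x => h * x) ⁻¹' U) := by
      rw [preimage_symmDiff]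
      simp only [preimage_preimage, mul_assoc]
    rw [← hm, he]
    exact measureReal_symmDiff_le _
  inv' g := by
    have hm := (measurePreserving_mul_left μ g).measureReal_preimage
      (((measurable_const_mul g⁻¹ hU).symmDiff hU).nullMeasurableSet)
    rw [← hm, preimage_symmDiff, symmDiff_comm]
    simp [preimage_preimage]

lemma symmDiffSeminorm_apply [IsTopologicalGroup K] [MeasurableSpace K] [BorelSpace K]
    (μ : Measure K) [IsFiniteMeasure μ] [μ.IsMulLeftInvariant] {U : Set K}
    (hU : MeasurableSet U) (g : K) :
    symmDiffSeminorm μ hU g = μ.real (((fun x => g * x) ⁻¹' U) ∆ U) := rfl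

lemma continuous_symmDiffSeminorm [IsTopologicalGroup K] [MeasurableSpace K] [BorelSpace K]
    (μ : Measure K) [IsFiniteMeasure μ] [μ.IsMulLeftInvariant] [μ.InnerRegularCompactLTTop]
    {U : Set K} (hU : MeasurableSet U) : Continuous (symmDiffSeminorm μ hU) := by
  refine continuous_groupSeminorm _ fun ε hε => ?_
  let f : C(K, C(K, K)) := ContinuousMap.curry ⟨fun q : K × K => q.1 * q.2, continuous_mul⟩
  have hf := tendsto_measure_symmDiff_preimage_nhds_zero (μ := μ) (ν := μ) (s := U)
    (f.continuous.tendsto 1)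
    (Eventually.of_forall fun g => measurePreserving_mul_left μ g)
    (measurePreserving_mul_left μ 1) hU.nullMeasurableSet (measure_ne_top μ U)
  filter_upwards [ENNReal.tendsto_nhds_zero.1 hf _ (ENNReal.ofReal_pos.2 hε)] with g hg
  rw [symmDiffSeminorm_apply]
  refine ENNReal.toReal_le_of_le_ofReal hε.le ?_
  have h1 : ⇑(f 1) ⁻¹' U = U := by
    ext x
    change 1 * x ∈ U ↔ _
    rw [one_mul]
  rw [h1] at hg
  exact hg

/-- A distal automorphism has a nonzero invariant seminorm vanishing on any given proper closed
normal invariant subgroup. -/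
lemma DistalAut.exists_invariantSeminorm [IsTopologicalGroup K] [CompactSpace K] [T2Space K]
    [SecondCountableTopology K]
    {α : ↥(ContAut K)} (hα : DistalAut α) {N : Subgroup K} (hNn : N.Normal)
    (hNc : IsClosed (N : Set K))
    (hN : ∀ x, (α : MulAut K) x ∈ N ↔ x ∈ N) (hNt : N ≠ ⊤) :
    ∃ p, IsInvariantSeminorm {α} p ∧ (∀ x ∈ N, p x = 0) ∧ ∃ x, p x ≠ 0 := by
  obtain ⟨U, hUo, hUne, hUd, hUα, hUN⟩ := hα.exists_invariant_open hNc hN hNt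
  let _ : MeasurableSpace K := borel K
  have : BorelSpace K := ⟨rfl⟩
  let μ : Measure K := Measure.haar
  have hU := hUo.measurableSet
  let p₀ := symmDiffSeminorm μ hU
  have hp₀ : Continuous p₀ := continuous_symmDiffSeminorm μ hU
  have hp₀α : ∀ g, p₀ ((α : MulAut K) g) = p₀ g := by
    intro g
    have hmp : MeasurePreserving (α : MulAut K) μ μ :=
      MonoidHom.measurePreserving (f := ((α : MulAut K) : K ≃* K).toMonoidHom)
        (ContAut.continuous α) (α : MulAut K).surjective rfl
    change μ.real _ = μ.real _
    rw [← hmp.measureReal_preimage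
      ((measurable_const_mul ((α : MulAut K) g) hU).symmDiff hU).nullMeasurableSet,
      preimage_symmDiff]
    congr 2
    · ext x
      simp only [mem_preimage, ← map_mul, hUα]
    · ext x
      exact hUα x
  have hp₀N : ∀ g ∈ N, p₀ g = 0 := by
    intro g hg
    have h : (fun x => g * x) ⁻¹' U = U := by
      ext x
      have hc : ∀ n ∈ N, ∀ y ∈ U, n * y ∈ U := by
        intro n hn y hy
        have h := hUN y hy _ (hNn.conj_mem n hn y⁻¹)
        simpa [← mul_assoc] using h
      refine ⟨fun hx => ?_, hc g hg x⟩
      simpa using hc _ (N.inv_mem hg) _ hx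
    change μ.real (_ ∆ _) = 0
    rw [h]
    simp
  obtain ⟨g₀, hg₀⟩ : ∃ g, 0 < p₀ g := by
    rw [dense_iff_closure_eq, ← ne_eq, ne_univ_iff_exists_notMem] at hUd
    obtain ⟨w, hw⟩ := hUd
    obtain ⟨u, hu⟩ := hUne
    refine ⟨u * w⁻¹, ?_⟩
    have ho : IsOpen (((fun x => u * w⁻¹ * x) ⁻¹' U) ∩ (closure U)ᶜ) :=
      (hUo.preimage (continuous_const_mul _)).inter isClosed_closure.isOpen_compl
    have hpos := ho.measure_pos μ ⟨w, by simpa using hu, hw⟩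
    refine ENNReal.toReal_pos (hpos.trans_le (measure_mono ?_)).ne' (measure_ne_top _ _)
    exact fun x hx => Or.inl ⟨hx.1, fun h => hx.2 (subset_closure h)⟩
  let P : K → GroupSeminorm K := fun k => p₀.comp (MulAut.conj k).toMonoidHom
  have hP : ∀ k x, P k x = p₀ (k * x * k⁻¹) := fun k x => rfl
  have hC : ∀ x, p₀ x ≤ μ.real univ := fun x => measureReal_mono (subset_univ _)
  obtain ⟨q, hqc, hq⟩ := exists_groupSeminorm_iSup P (μ.real univ) (fun k x => hC _) (by
    intro ε hε
    have hcont : Continuous fun z : K × K => P z.2 z.1 := by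
      simp only [hP]
      fun_prop
    have := isCompact_univ.eventually_forall_of_forall_eventually (x₀ := (1 : K))
      (P := fun g k => P k g < ε) (K := (univ : Set K)) (fun k _ => by
        refine hcont.continuousAt.eventually_lt_const ?_
        simpa [hP] using hε)
    filter_upwards [this] with g hg k
    exact (hg k (mem_univ k)).le)
  have hb : ∀ x, BddAbove (range fun k => P k x) := fun x =>
    ⟨μ.real univ, by rintro _ ⟨k, rfl⟩; exact hC _⟩
  refine ⟨q, ⟨hqc, fun h x => ?_, ?_⟩, fun x hx => ?_, g₀, ?_⟩
  · rw [hq, hq]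
    refine (Equiv.mulRight h).iSup_congr fun k => ?_
    simp [hP, mul_assoc]
  · intro γ hγ x
    obtain rfl : γ = α := hγ
    rw [hq, hq]
    symm
    refine (MulEquiv.toEquiv (γ : MulAut K)).iSup_congr fun k => ?_
    rw [hP, hP, ← hp₀α (k * x * k⁻¹)]
    simp
  · rw [hq]
    have : ∀ k, P k x = 0 := fun k => hp₀N _ (hNn.conj_mem x hx k)
    simp [this]
  · rw [hq]
    refine (hg₀.trans_le ?_).ne'
    have h := le_ciSup (hb g₀) 1
    simpa [hP] using h

/-- Finitely many commuting distal automorphisms have a common nonzero invariant seminorm vanishing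
on any given proper closed normal invariant subgroup. -/
lemma exists_invariantSeminorm [IsTopologicalGroup K] [CompactSpace K] [T2Space K]
    [SecondCountableTopology K] {T : Set ↥(ContAut K)} (hT : T.Finite)
    (hd : ∀ γ ∈ T, DistalAut γ) (hcomm : ∀ γ ∈ T, ∀ δ ∈ T, γ * δ = δ * γ)
    {N : Subgroup K} (hNn : N.Normal) (hNc : IsClosed (N : Set K))
    (hN : ∀ γ ∈ T, ∀ x, (γ : MulAut K) x ∈ N ↔ x ∈ N) (hNt : N ≠ ⊤) :
    ∃ p, IsInvariantSeminorm T p ∧ (∀ x ∈ N, p x = 0) ∧ ∃ x, p x ≠ 0 := by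
  induction T, hT using Set.Finite.induction_on generalizing N with
  | empty =>
    have hone : DistalAut (1 : ↥(ContAut K)) := by
      intro x hx
      simpa [← range_comp, Function.comp_def] using hx.symm
    obtain ⟨p, hp, hp'⟩ := hone.exists_invariantSeminorm hNn hNc (fun _ => Iff.rfl) hNt
    exact ⟨p, ⟨hp.continuous, hp.conj, by simp⟩, hp'⟩
  | @insert β T hβT hT ih =>
    have hβd := hd β (mem_insert _ _)
    let 𝓛 : Set (GroupSeminorm K) := {p | IsInvariantSeminorm {β} p ∧ ∀ x ∈ N, p x = 0}
    let N₁ : Subgroup K :=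
      { carrier := {x | ∀ p ∈ 𝓛, p x = 0}
        one_mem' := fun p _ => map_one_eq_zero p
        mul_mem' := fun {a b} ha hb p hp => le_antisymm
          ((map_mul_le_add p a b).trans (by rw [ha p hp, hb p hp, add_zero])) (apply_nonneg p _)
        inv_mem' := fun {a} ha p hp => (map_inv_eq_map p a).trans (ha p hp) }
    have hmem : ∀ x, x ∈ N₁ ↔ ∀ p ∈ 𝓛, p x = 0 := fun x => Iff.rfl
    have hN₁n : N₁.Normal := ⟨fun x hx k p hp => (hp.1.conj k x).trans (hx p hp)⟩
    have hN₁c : IsClosed (N₁ : Set K) := by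
      have : (N₁ : Set K) = ⋂ p ∈ 𝓛, {x | p x = 0} := by
        ext x
        simp [hmem]
      rw [this]
      exact isClosed_biInter fun p hp => isClosed_eq hp.1.continuous continuous_const
    have hN₁t : N₁ ≠ ⊤ := by
      obtain ⟨p, hp, hpN, x, hx⟩ :=
        hβd.exists_invariantSeminorm hNn hNc (hN β (mem_insert _ _)) hNt
      intro h
      exact hx ((h ▸ Subgroup.mem_top x : x ∈ N₁) p ⟨hp, hpN⟩)
    have hNN₁ : ∀ x ∈ N, x ∈ N₁ := fun x hx p hp => hp.2 x hx
    have hpull : ∀ δ : ↥(ContAut K), β * δ = δ * β →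
        (∀ x, (δ : MulAut K) x ∈ N ↔ x ∈ N) → ∀ x ∈ N₁, (δ : MulAut K) x ∈ N₁ := by
      intro δ hδ hδN x hx p hp
      refine hx (p.comp ((δ : MulAut K) : K ≃* K).toMonoidHom) ⟨⟨?_, fun k y => ?_, ?_⟩, ?_⟩
      · exact hp.1.continuous.comp (ContAut.continuous δ)
      · change p ((δ : MulAut K) (k * y * k⁻¹)) = p ((δ : MulAut K) y)
        rw [map_mul (δ : MulAut K), map_mul (δ : MulAut K), map_inv (δ : MulAut K), hp.1.conj]
      · rintro _ rfl y
        change p ((δ * _ : ↥(ContAut K)).1 y) = p ((δ : MulAut K) y)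
        rw [← hδ]
        exact hp.1.map_apply _ rfl _
      · exact fun y hy => hp.2 _ ((hδN y).2 hy)
    have hN₁T : ∀ γ ∈ T, ∀ x, (γ : MulAut K) x ∈ N₁ ↔ x ∈ N₁ := by
      intro γ hγ x
      have hc := hcomm β (mem_insert _ _) γ (mem_insert_of_mem _ hγ)
      have hγN := hN γ (mem_insert_of_mem _ hγ)
      refine ⟨fun h => ?_, hpull γ hc hγN x⟩
      have h' := hpull γ⁻¹ ((show Commute β γ from hc).inv_right)
        (fun y => by simpa using zpow_apply_mem hγN (-1) y) _ h
      have he : ((γ⁻¹ : ↥(ContAut K)) : MulAut K) ((γ : MulAut K) x) = x :=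
        (γ : MulAut K).symm_apply_apply x
      rwa [he] at h'
    obtain ⟨p, hp, hpN, g₀, hg₀⟩ := ih (fun γ hγ => hd γ (mem_insert_of_mem _ hγ))
      (fun γ hγ δ hδ => hcomm γ (mem_insert_of_mem _ hγ) δ (mem_insert_of_mem _ hδ))
      hN₁n hN₁c hN₁T hN₁t
    let P : ℤ → GroupSeminorm K := fun k =>
      p.comp (((β ^ k : ↥(ContAut K)) : MulAut K) : K ≃* K).toMonoidHom
    have hP : ∀ k x, P k x = p (((β ^ k : ↥(ContAut K)) : MulAut K) x) := fun _ _ => rfl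
    obtain ⟨C, hC⟩ : ∃ C, ∀ x, p x ≤ C := by
      obtain ⟨C, hC⟩ := (isCompact_range hp.continuous).bddAbove
      exact ⟨C, fun x => hC ⟨x, rfl⟩⟩
    have hequi : ∀ ε > 0, ∀ᶠ g in 𝓝 (1 : K), ∀ k, P k g ≤ ε := by
      intro ε hε
      have hclosed : IsClosed {x | ε ≤ p x} := isClosed_le continuous_const hp.continuous
      obtain ⟨r, hr, hrpos⟩ : ∃ r ∈ 𝓛, ∀ x ∈ {x | ε ≤ p x}, 0 < r x := by
        refine hclosed.isCompact.induction_on (p := fun s => ∃ r ∈ 𝓛, ∀ x ∈ s, 0 < r x)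
          ⟨0, ⟨⟨continuous_const, fun _ _ => rfl, fun _ _ _ => rfl⟩, fun _ _ => rfl⟩, by simp⟩
          ?_ ?_ ?_
        · rintro s t hst ⟨r, hr, h⟩
          exact ⟨r, hr, fun x hx => h x (hst hx)⟩
        · rintro s t ⟨r, hr, h⟩ ⟨r', hr', h'⟩
          refine ⟨r + r', ⟨⟨?_, fun k x => ?_, fun γ hγ x => ?_⟩, fun x hx => ?_⟩, ?_⟩
          · exact hr.1.continuous.add hr'.1.continuous
          · simp only [add_apply, hr.1.conj, hr'.1.conj]
          · simp only [add_apply, hr.1.map_apply γ hγ, hr'.1.map_apply γ hγ]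
          · simp only [add_apply, hr.2 x hx, hr'.2 x hx, add_zero]
          · rintro x (hx | hx)
            · exact add_pos_of_pos_of_nonneg (h x hx) (apply_nonneg r' x)
            · exact add_pos_of_nonneg_of_pos (apply_nonneg r x) (h' x hx)
        · intro x hx
          have hx₁ : x ∉ N₁ := fun h => by
            have h0 := hpN x h
            have hx' : ε ≤ p x := hx
            linarith
          rw [hmem] at hx₁
          push Not at hx₁
          obtain ⟨r, hr, hrx⟩ := hx₁
          refine ⟨{y | 0 < r y}, mem_nhdsWithin_of_mem_nhds ?_, r, hr, fun y hy => hy⟩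
          exact (isOpen_lt continuous_const hr.1.continuous).mem_nhds
            (lt_of_le_of_ne (apply_nonneg r x) hrx.symm)
      obtain ⟨δ, hδ, hδr⟩ : ∃ δ > 0, ∀ x, ε ≤ p x → δ ≤ r x := by
        rcases eq_empty_or_nonempty {x | ε ≤ p x} with he | hne
        · exact ⟨1, one_pos, fun x hx => (he ▸ hx : x ∈ (∅ : Set K)).elim⟩
        · obtain ⟨x, hx, hmin⟩ :=
            hclosed.isCompact.exists_isMinOn hne hr.1.continuous.continuousOn
          exact ⟨r x, hrpos x hx, fun y hy => hmin hy⟩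
      have hev : ∀ᶠ g in 𝓝 (1 : K), r g < δ :=
        hr.1.continuous.continuousAt.eventually_lt_const (by simpa using hδ)
      filter_upwards [hev] with g hg k
      by_contra! hlt
      have h1 := hδr _ hlt.le
      have hβr : β ∈ invariants r := hr.1.map_apply β rfl
      have h2 := (invariants r).zpow_mem hβr k g
      change δ ≤ r (((β ^ k : ↥(ContAut K)) : MulAut K) g) at h1
      linarith
    obtain ⟨q, hqc, hq⟩ := exists_groupSeminorm_iSup P C (fun k x => hC _) hequi
    refine ⟨q, ⟨hqc, fun k x => ?_, ?_⟩, fun x hx => ?_, g₀, ?_⟩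
    · rw [hq, hq]
      congr 1
      funext j
      let b : MulAut K := ((β ^ j : ↥(ContAut K)) : MulAut K)
      change p (b (k * x * k⁻¹)) = p (b x)
      rw [map_mul b, map_mul b, map_inv b, hp.conj]
    · intro γ hγ x
      rw [hq, hq]
      rcases mem_insert_iff.1 hγ with rfl | hγT
      · refine (Equiv.addRight (1 : ℤ)).iSup_congr fun k => ?_
        rw [hP, hP, Equiv.coe_addRight, zpow_add_one]
        rfl
      · congr 1
        funext k
        have hc : Commute γ β := hcomm γ hγ β (mem_insert _ _)
        have he : β ^ k * γ = γ * β ^ k := (hc.zpow_right k).eq.symm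
        change p ((β ^ k * γ : ↥(ContAut K)).1 x) = _
        rw [he]
        exact hp.map_apply γ hγT _
    · rw [hq]
      have hz : ∀ k, P k x = 0 := fun k =>
        hpN _ (hNN₁ _ ((zpow_apply_mem (hN β (mem_insert _ _)) k x).2 hx))
      simp [hz]
    · rw [hq]
      have hb : BddAbove (range fun k => P k g₀) := ⟨C, by rintro _ ⟨k, rfl⟩; exact hC _⟩
      have h := le_ciSup hb 0
      have hpos : 0 < p g₀ := lt_of_le_of_ne (apply_nonneg p g₀) hg₀.symm
      exact (hpos.trans_le h).ne'

end Seminorms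

section Restriction

variable [Group K] [TopologicalSpace K]

lemma restrictAut_zpow_coe (L : Subgroup K) (α : ↥(ContAut K))
    (h : ∀ x, x ∈ L ↔ (α : MulAut K) x ∈ L) (k : ℤ) (x : ↥L) :
    ((((restrictAut L α h ^ k : ↥(ContAut ↥L)) : MulAut ↥L) x : ↥L) : K) =
      ((α ^ k : ↥(ContAut K)) : MulAut K) (x : K) := by
  induction k generalizing x with
  | zero => rfl
  | succ k ih =>
    rw [zpow_add_one, zpow_add_one]
    exact ih _
  | pred k ih =>
    rw [zpow_sub_one, zpow_sub_one]
    exact ih _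

lemma DistalAut.restrictAut {α : ↥(ContAut K)} (hα : DistalAut α) (L : Subgroup K)
    (h : ∀ x, x ∈ L ↔ (α : MulAut K) x ∈ L) : DistalAut (restrictAut L α h) := by
  intro x hx hcl
  refine hα x (by simpa using hx) ?_
  have hmem := image_closure_subset_closure_image continuous_subtype_val
    (mem_image_of_mem ((↑) : ↥L → K) hcl)
  refine closure_mono ?_ hmem
  rintro _ ⟨_, ⟨_, ⟨k, rfl⟩, rfl⟩, rfl⟩
  exact ⟨α ^ k, ⟨k, rfl⟩, (restrictAut_zpow_coe L α h k x).symm⟩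

end Restriction

/-- Lemma 3.4. Let `α 1, …, α n` be pairwise commuting continuous
automorphisms of a compact metrizable group `K`. Then each `α i` is distal on
`K` if and only if the group generated by `α 1, …, α n` is distal on `K`. -/
theorem statement8 {K : Type*} [Group K] [TopologicalSpace K] [IsTopologicalGroup K]
    [CompactSpace K] [TopologicalSpace.MetrizableSpace K]
    {n : ℕ} (α : Fin n → ↥(ContAut K))
    (hcomm : ∀ i j, α i * α j = α j * α i) :
    (∀ i, DistalAut (α i)) ↔
      DistalSet ((Subgroup.closure (Set.range α) : Subgroup ↥(ContAut K)) :
        Set ↥(ContAut K)) := by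
  constructor
  · intro hd x hx hcl
    let _ := TopologicalSpace.metrizableSpaceMetric K
    let Γ : Subgroup ↥(ContAut K) := Subgroup.closure (range α)
    let A : Set K := (fun γ : ↥(ContAut K) => (γ : MulAut K) x) '' Γ
    let L : Subgroup K := (Subgroup.closure A).topologicalClosure
    have hAL : A ⊆ L := Subgroup.subset_closure.trans (Subgroup.le_topologicalClosure _)
    have hLc : IsClosed (L : Set K) := Subgroup.isClosed_topologicalClosure _
    have hmin : ∀ M : Subgroup K, IsClosed (M : Set K) → A ⊆ M → L ≤ M := fun M hM hAM =>
      Subgroup.topologicalClosure_minimal _ ((Subgroup.closure_le M).2 hAM) hM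
    have hLΓ : ∀ γ ∈ Γ, ∀ y ∈ L, (γ : MulAut K) y ∈ L := by
      intro γ hγ
      refine hmin (L.comap ((γ : MulAut K) : K ≃* K).toMonoidHom)
        (hLc.preimage (ContAut.continuous γ)) ?_
      rintro _ ⟨δ, hδ, rfl⟩
      exact hAL ⟨γ * δ, Γ.mul_mem hγ hδ, rfl⟩
    have hLα : ∀ i y, y ∈ L ↔ (α i : MulAut K) y ∈ L := by
      intro i y
      have hi : α i ∈ Γ := Subgroup.subset_closure ⟨i, rfl⟩
      refine ⟨hLΓ _ hi y, fun h => ?_⟩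
      have h' := hLΓ _ (Γ.inv_mem hi) _ h
      have he : (((α i)⁻¹ : ↥(ContAut K)) : MulAut K) ((α i : MulAut K) y) = y :=
        (α i : MulAut K).symm_apply_apply y
      rwa [he] at h'
    have hxL : x ∈ L := hAL ⟨1, Γ.one_mem, rfl⟩
    have : CompactSpace ↥L := isCompact_iff_compactSpace.1 hLc.isCompact
    obtain ⟨p, hp, -, y, hy⟩ := exists_invariantSeminorm (K := ↥L)
      (T := range fun i => restrictAut L (α i) (hLα i)) (finite_range _)
      (by rintro _ ⟨i, rfl⟩; exact (hd i).restrictAut L (hLα i))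
      (by
        rintro _ ⟨i, rfl⟩ _ ⟨j, rfl⟩
        ext z
        exact congrArg (fun γ : ↥(ContAut K) => (γ : MulAut K) z) (hcomm i j))
      (N := ⊥) inferInstance (by simp)
      (by rintro _ ⟨i, rfl⟩ z; simp)
      (by
        intro h
        have : (⟨x, hxL⟩ : ↥L) ∈ (⊥ : Subgroup ↥L) := h ▸ Subgroup.mem_top _
        exact hx (congrArg Subtype.val (Subgroup.mem_bot.1 this)))
    classical
    let f : K → ℝ := fun z => if h : z ∈ L then p ⟨z, h⟩ else 0
    have hf : ∀ z : ↥L, f z = p z := fun z => dif_pos z.2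
    have hΓf : Γ ≤ invariants f := by
      refine (Subgroup.closure_le _).2 ?_
      rintro _ ⟨i, rfl⟩ z
      by_cases hz : z ∈ L
      · have h := hp.map_apply _ ⟨i, rfl⟩ ⟨z, hz⟩
        rw [← hf, ← hf] at h
        exact h
      · have hz' : (α i : MulAut K) z ∉ L := fun h => hz ((hLα i z).2 h)
        simp only [f, dif_neg hz, dif_neg hz']
    have hfA : ∀ z ∈ A, f z = f x := by
      rintro _ ⟨γ, hγ, rfl⟩
      exact hΓf hγ x
    have hfx : f x = 0 := by
      have hcl' : (1 : ↥L) ∈ closure (((↑) : ↥L → K) ⁻¹' A) := by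
        have himage : ((↑) : ↥L → K) '' (((↑) : ↥L → K) ⁻¹' A) = A :=
          image_preimage_eq_of_subset fun z hz => ⟨⟨z, hAL hz⟩, rfl⟩
        refine closure_subtype.2 ?_
        rw [himage]
        exact hcl
      have h1 : p 1 = f x := closure_minimal (t := {z : ↥L | p z = f x})
        (fun z hz => (hf z).symm.trans (hfA z hz))
        (isClosed_eq hp.continuous continuous_const) hcl'
      rw [← h1, map_one_eq_zero]
    let Z : Subgroup ↥L :=
      { carrier := {z | p z = 0}
        one_mem' := map_one_eq_zero p
        mul_mem' := fun {a b} ha hb => le_antisymm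
          ((map_mul_le_add p a b).trans (by
            rw [show p a = 0 from ha, show p b = 0 from hb, add_zero])) (apply_nonneg p _)
        inv_mem' := fun {a} ha => (map_inv_eq_map p a).trans ha }
    have hZc : IsClosed (Z : Set ↥L) := isClosed_eq hp.continuous continuous_const
    have hLZ : L ≤ Z.map L.subtype := by
      refine hmin _ (hLc.isClosedEmbedding_subtypeVal.isClosedMap _ hZc) fun z hz => ?_
      exact ⟨⟨z, hAL hz⟩, (hf _).symm.trans ((hfA z hz).trans hfx), rfl⟩
    obtain ⟨z, hz, hzy⟩ := hLZ y.2
    exact hy (Subtype.ext hzy ▸ hz)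
  · intro hd i x hx hcl
    refine hd x hx (closure_mono (image_mono ?_) hcl)
    rintro _ ⟨k, rfl⟩
    exact Subgroup.zpow_mem _ (Subgroup.subset_closure (mem_range_self i)) k

end ErgZd
end

section
/- Let M be a non-trivial compact metrizable group and Γ a countably infinite group. Then the shift action of Γ on the compact group M^Γ (with the product topology) is not distal. In particular, if Γ is a finitely generated infinite torsion group, every element of Γ acts distally on M^Γ while the group Γ itself does not act distally, so distality of each generator does not imply distality of the group for non-abelian acting groups. -/
open MeasureTheory Topology Set

set_option linter.unusedVariables false

namespace ErgZd

variable {K : Type*}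

section Shift

/-- The shift automorphism of `M^Γ` given by `γ ∈ Γ`: `(γ • f) β = f (γ⁻¹ * β)`. -/
def shiftAut (Γ : Type*) [Group Γ] (M : Type*) [Group M] [TopologicalSpace M] (γ : Γ) :
    ↥(ContAut (Γ → M)) := by
  refine ⟨⟨⟨fun f β => f (γ⁻¹ * β), fun f β => f (γ * β), ?_, ?_⟩, ?_⟩, ?_, ?_⟩
  · intro f; funext β; simp
  · intro f; funext β; simp
  · intro f g; rfl
  · exact continuous_pi fun β => continuous_apply _
  · exact continuous_pi fun β => continuous_apply _

end Shift

@[simp] lemma shiftAut_apply {Γ M : Type*} [Group Γ] [Group M] [TopologicalSpace M]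
    (γ : Γ) (f : Γ → M) (β : Γ) : (shiftAut Γ M γ : MulAut (Γ → M)) f β = f (γ⁻¹ * β) := rfl

/-- The shift action as a homomorphism into the group of automorphisms. -/
def shiftHom (Γ : Type*) [Group Γ] (M : Type*) [Group M] [TopologicalSpace M] :
    Γ →* ↥(ContAut (Γ → M)) :=
  MonoidHom.mk' (shiftAut Γ M) fun a b => by
    apply Subtype.ext
    apply MulEquiv.ext
    intro f
    funext β
    simp [mul_assoc]

/-- A finite set of automorphisms of a `T₁` group acts distally. -/
lemma distalSet_of_finite {K : Type*} [Group K] [TopologicalSpace K] [T1Space K]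
    {S : Set ↥(ContAut K)} (hS : S.Finite) : DistalSet S := by
  intro x hx h
  rw [(hS.image _).isClosed.closure_eq] at h
  obtain ⟨α, -, hα⟩ := h
  exact hx ((map_eq_one_iff _ (α : MulAut K).injective).mp hα)

lemma distalAut_of_isOfFinOrder {K : Type*} [Group K] [TopologicalSpace K] [T1Space K]
    {α : ↥(ContAut K)} (hα : IsOfFinOrder α) : DistalAut α :=
  distalSet_of_finite <| by
    rw [← Subgroup.coe_zpowers]
    exact hα.finite_zpowers

/-- The shift action of an infinite group on `M^Γ` is not distal: the orbit of a function
supported at a single point accumulates at the identity. -/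
lemma not_distalSet_range_shiftAut (Γ : Type*) [Group Γ] [Infinite Γ]
    (M : Type*) [Group M] [TopologicalSpace M] (hM : ∃ x : M, x ≠ 1) :
    ¬ DistalSet (Set.range (shiftAut Γ M)) := by
  classical
  obtain ⟨x, hx⟩ := hM
  intro h
  refine h (Pi.mulSingle 1 x) (by simpa using hx) ?_
  refine mem_closure_of_tendsto (b := Filter.cofinite)
    (f := fun γ : Γ => (shiftAut Γ M γ : MulAut (Γ → M)) (Pi.mulSingle 1 x)) ?_
    (Filter.Eventually.of_forall fun γ => ⟨_, ⟨γ, rfl⟩, rfl⟩)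
  refine tendsto_pi_nhds.mpr fun β => tendsto_const_nhds.congr' ?_
  filter_upwards [(Set.finite_singleton β).compl_mem_cofinite] with γ hγ
  have hne : γ⁻¹ * β ≠ 1 := fun h => hγ (inv_mul_eq_one.mp h)
  simp [Pi.mulSingle_eq_of_ne hne]

/-- Example 3.5. For a non-trivial compact metrizable group `M` and a
countably infinite group `Γ`, the shift action of `Γ` on `M^Γ` is not distal.  In
particular, if `Γ` is moreover finitely generated and torsion, then every element of `Γ`
acts distally on `M^Γ` while the group `Γ` itself does not act distally. -/
theorem statement9 (Γ : Type*) [Group Γ] [Countable Γ] [Infinite Γ]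
    (M : Type*) [Group M] [TopologicalSpace M] [IsTopologicalGroup M]
    [CompactSpace M] [TopologicalSpace.MetrizableSpace M]
    (hM : ∃ x : M, x ≠ 1) :
    ¬ DistalSet (Set.range (shiftAut Γ M))
    ∧ ((∃ S : Finset Γ, Subgroup.closure (S : Set Γ) = ⊤) →
        (∀ γ : Γ, ∃ k : ℕ, 0 < k ∧ γ ^ k = 1) →
        (∀ γ : Γ, DistalAut (shiftAut Γ M γ)) ∧ ¬ DistalSet (Set.range (shiftAut Γ M))) := by
  refine ⟨not_distalSet_range_shiftAut Γ M hM, fun _ htors =>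
    ⟨fun γ => ?_, not_distalSet_range_shiftAut Γ M hM⟩⟩
  exact distalAut_of_isOfFinOrder
    ((shiftHom Γ M).isOfFinOrder (isOfFinOrder_iff_pow_eq_one.mpr (htors γ)))

end ErgZd
end

section
/- Let K be a compact metrizable group and Γ a finitely generated abelian group of continuous automorphisms of K. Suppose Γ is ergodic on K and the center Z(Γ) of the action has DCC on K. Then there exists α ∈ Γ which is ergodic on K. Furthermore, if Γ is generated by α₁, …, α_n, then there exist positive integers i₁, …, i_n such that α₁^{i₁} α₂^{i₂} ⋯ α_n^{i_n} is ergodic on K. -/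
open MeasureTheory Topology Set

set_option linter.unusedVariables false

namespace ErgZd

variable {K : Type*}

section Prolongation

open Filter
open scoped symmDiff Pointwise

variable [Group K] [TopologicalSpace K]

/-- The limits of sequences `γ n (v n)` with `γ n ∈ S` and `v n → 1`. -/
def prolongation (S : Set ↥(ContAut K)) : Set K :=
  {x | ∃ (γ : ℕ → ↥(ContAut K)) (v : ℕ → K), (∀ n, γ n ∈ S) ∧ Tendsto v atTop (𝓝 1) ∧
    Tendsto (fun n => (γ n : MulAut K) (v n)) atTop (𝓝 x)}

/-- The subgroup `H` is mapped into itself by every element of `S`. -/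
def MapsInto (S : Set ↥(ContAut K)) (H : Subgroup K) : Prop :=
  ∀ γ ∈ S, ∀ x ∈ H, (γ : MulAut K) x ∈ H

lemma conj_mem_prolongation [IsTopologicalGroup K] [CompactSpace K]
    [TopologicalSpace.MetrizableSpace K] {S : Set ↥(ContAut K)} {x : K}
    (hx : x ∈ prolongation S) (h : K) : h * x * h⁻¹ ∈ prolongation S := by
  obtain ⟨γ, v, hγ, hv, hx⟩ := hx
  obtain ⟨k, -, φ, hφ, hk⟩ := isCompact_univ.tendsto_subseq
    (x := fun n => (γ n : MulAut K).symm h) fun _ => mem_univ _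
  refine ⟨γ ∘ φ, fun n => (γ (φ n) : MulAut K).symm h * v (φ n) *
    ((γ (φ n) : MulAut K).symm h)⁻¹, fun n => hγ _, ?_, ?_⟩
  · simpa using (hk.mul (hv.comp hφ.tendsto_atTop)).mul hk.inv
  · have := ((hx.comp hφ.tendsto_atTop).const_mul h).mul_const h⁻¹
    simpa [Function.comp_def] using this

lemma prolongation_equivariant {S : Set ↥(ContAut K)} {β : ↥(ContAut K)}
    (hβ : ∀ γ ∈ S, β * γ = γ * β) {x : K} (hx : x ∈ prolongation S) :
    (β : MulAut K) x ∈ prolongation S := by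
  obtain ⟨γ, v, hγ, hv, hx⟩ := hx
  refine ⟨γ, fun n => (β : MulAut K) (v n), hγ, ?_, ?_⟩
  · exact ((ContAut.continuous β).tendsto' 1 1 (map_one _)).comp hv
  · have h (n : ℕ) : (γ n : MulAut K) ((β : MulAut K) (v n)) =
        (β : MulAut K) ((γ n : MulAut K) (v n)) :=
      (DFunLike.congr_fun (congrArg Subtype.val (hβ _ (hγ n))) (v n)).symm
    simpa only [h, Function.comp_def] using ((ContAut.continuous β).tendsto x).comp hx

/-- Finitely many automorphisms are equicontinuous. -/
lemma prolongation_subset_of_finite [IsTopologicalGroup K] [T2Space K]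
    {S : Set ↥(ContAut K)} (hS : S.Finite) (H : Subgroup K) : prolongation S ⊆ H := by
  rintro x ⟨γ, v, hγ, hv, hx⟩
  suffices Tendsto (fun n => (γ n : MulAut K) (v n)) atTop (𝓝 1) by
    rw [tendsto_nhds_unique hx this]
    exact H.one_mem
  refine tendsto_def.2 fun U hU => ?_
  have hall : ∀ᶠ n in atTop, ∀ β ∈ S, (β : MulAut K) (v n) ∈ U := by
    rw [eventually_all_finite hS]
    intro β _
    exact hv (((ContAut.continuous β).tendsto' 1 1 (map_one _)) hU)
  filter_upwards [hall] with n hn using hn _ (hγ n)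

/-- Equicontinuity modulo `H` is inherited by products. -/
lemma prolongation_subset_of_mul [IsTopologicalGroup K] [CompactSpace K]
    [TopologicalSpace.MetrizableSpace K] {S T U : Set ↥(ContAut K)} {H : Subgroup K}
    (hH : IsClosed (H : Set K)) (hSH : MapsInto S H)
    (hS : prolongation S ⊆ H) (hT : prolongation T ⊆ H)
    (hU : ∀ γ ∈ U, ∃ s ∈ S, ∃ t ∈ T, γ = s * t) : prolongation U ⊆ H := by
  rintro x ⟨γ, v, hγ, hv, hx⟩
  choose s hs t ht hst using fun n => hU _ (hγ n)
  obtain ⟨y, -, φ, hφ, hy⟩ := isCompact_univ.tendsto_subseq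
    (x := fun n => (t n : MulAut K) (v n)) fun _ => mem_univ _
  have hyH : y ∈ H := hT ⟨t ∘ φ, v ∘ φ, fun n => ht _, hv.comp hφ.tendsto_atTop, hy⟩
  obtain ⟨z, hz, ψ, hψ, hzlim⟩ := (hH.isCompact).tendsto_subseq
    (x := fun n => (s (φ n) : MulAut K) y) fun n => hSH _ (hs _) _ hyH
  have hw : x * z⁻¹ ∈ H := by
    refine hS ⟨s ∘ φ ∘ ψ, fun n => (t (φ (ψ n)) : MulAut K) (v (φ (ψ n))) * y⁻¹,
      fun n => hs _, ?_, ?_⟩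
    · simpa using (hy.comp hψ.tendsto_atTop).mul_const y⁻¹
    · have := (hx.comp (hφ.comp hψ).tendsto_atTop).mul hzlim.inv
      simpa [Function.comp_def, hst] using this
  simpa using H.mul_mem hw hz

/-- If `D * A` is the whole group, equicontinuity modulo `N` yields equicontinuity modulo
`(D ∩ N) * A`. -/
lemma prolongation_subset_inf_sup [IsTopologicalGroup K] [CompactSpace K]
    [TopologicalSpace.MetrizableSpace K] {S : Set ↥(ContAut K)} {D N A : Subgroup K}
    (hD : IsClosed (D : Set K)) (hA : IsClosed (A : Set K))
    (hSD : MapsInto S D) (hSA : MapsInto S A) (hDA : ∀ x, ∃ d ∈ D, ∃ a ∈ A, d * a = x)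
    (hN : prolongation S ⊆ N) :
    prolongation S ⊆ (D ⊓ N ⊔ A : Subgroup K) := by
  rintro x ⟨γ, v, hγ, hv, hx⟩
  choose d hd a ha hda using fun n => hDA (v n)
  obtain ⟨d₀, hd₀, φ, hφ, hdlim⟩ := hD.isCompact.tendsto_subseq hd
  obtain ⟨a₀, ha₀, ψ, hψ, halim⟩ := hA.isCompact.tendsto_subseq fun n => ha (φ n)
  have hda₀ : d₀ * a₀ = 1 := by
    refine tendsto_nhds_unique ((hdlim.comp hψ.tendsto_atTop).mul halim) ?_
    simpa [Function.comp_def, hda] using hv.comp (hφ.comp hψ).tendsto_atTop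
  have hd₀A : d₀ ∈ A := by
    rw [eq_inv_of_mul_eq_one_left hda₀]
    exact A.inv_mem ha₀
  obtain ⟨p, hp, θ, hθ, hplim⟩ := hD.isCompact.tendsto_subseq
    (x := fun n => (γ (φ (ψ n)) : MulAut K) (d (φ (ψ n)) * d₀⁻¹))
    fun n => hSD _ (hγ _) _ (D.mul_mem (hd _) (D.inv_mem hd₀))
  have hpN : p ∈ N := by
    refine hN ⟨γ ∘ φ ∘ ψ ∘ θ, fun n => d (φ (ψ (θ n))) * d₀⁻¹, fun n => hγ _, ?_, hplim⟩
    simpa using (hdlim.comp (hψ.comp hθ).tendsto_atTop).mul_const d₀⁻¹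
  have hpA : p⁻¹ * x ∈ A := by
    have hlim := hplim.inv.mul (hx.comp (hφ.comp (hψ.comp hθ)).tendsto_atTop)
    refine hA.mem_of_tendsto hlim (Eventually.of_forall fun n => ?_)
    have : (γ (φ (ψ (θ n))) : MulAut K) (d₀ * a (φ (ψ (θ n)))) ∈ A :=
      hSA _ (hγ _) _ (A.mul_mem hd₀A (ha _))
    simpa [← hda] using this
  have := Subgroup.mul_mem_sup (Subgroup.mem_inf.2 ⟨hp, hpN⟩) hpA
  simpa using this

/-- The smallest closed subgroup modulo which `S` is equicontinuous. -/
def ergCore [IsTopologicalGroup K] (S : Set ↥(ContAut K)) : Subgroup K :=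
  (Subgroup.closure (prolongation S)).topologicalClosure

section ErgCore

variable [IsTopologicalGroup K]

lemma isClosed_ergCore (S : Set ↥(ContAut K)) : IsClosed (ergCore S : Set K) :=
  Subgroup.isClosed_topologicalClosure _

lemma prolongation_subset_ergCore (S : Set ↥(ContAut K)) : prolongation S ⊆ ergCore S :=
  Subgroup.subset_closure.trans (Subgroup.le_topologicalClosure _)

lemma ergCore_le {S : Set ↥(ContAut K)} {H : Subgroup K} (hH : IsClosed (H : Set K))
    (h : prolongation S ⊆ H) : ergCore S ≤ H :=
  Subgroup.topologicalClosure_minimal _ ((Subgroup.closure_le _).2 h) hH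

lemma normal_ergCore [CompactSpace K] [TopologicalSpace.MetrizableSpace K]
    (S : Set ↥(ContAut K)) : (ergCore S).Normal := by
  have : (Subgroup.closure (prolongation S)).Normal := by
    have h : Subgroup.normalClosure (prolongation S) ≤ Subgroup.closure (prolongation S) := by
      refine (Subgroup.closure_le _).2 fun x hx => ?_
      obtain ⟨y, hy, hyx⟩ := Group.mem_conjugatesOfSet_iff.1 hx
      obtain ⟨c, rfl⟩ := isConj_iff.1 hyx
      exact Subgroup.subset_closure (conj_mem_prolongation hy c)
    rw [le_antisymm Subgroup.closure_le_normalClosure h]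
    infer_instance
  exact Subgroup.is_normal_topologicalClosure _

lemma mem_ergCore_of_commute {S : Set ↥(ContAut K)} {β : ↥(ContAut K)}
    (hβ : ∀ γ ∈ S, β * γ = γ * β) {x : K} (hx : x ∈ ergCore S) :
    (β : MulAut K) x ∈ ergCore S := by
  have h : ergCore S ≤ (ergCore S).comap (β : MulAut K).toMonoidHom :=
    ergCore_le ((isClosed_ergCore S).preimage (ContAut.continuous β)) fun y hy =>
      prolongation_subset_ergCore S (prolongation_equivariant hβ hy)
  exact h hx

end ErgCore

lemma secondCountableTopology_of_compact_metrizable (X : Type*) [TopologicalSpace X]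
    [CompactSpace X] [TopologicalSpace.MetrizableSpace X] : SecondCountableTopology X :=
  letI := TopologicalSpace.metrizableSpaceMetric X
  inferInstance

section Measure

variable [TopologicalSpace.MetrizableSpace K] [MeasurableSpace K] [BorelSpace K]
  (μ : Measure K) [μ.IsHaarMeasure]

/-- An ergodic group of automorphisms spreads each neighbourhood of `1` densely. -/
lemma mem_prolongation_of_ergSet [IsProbabilityMeasure μ] {Λ : Subgroup ↥(ContAut K)}
    (h : ErgSet μ (Λ : Set ↥(ContAut K))) (x : K) : x ∈ prolongation (Λ : Set ↥(ContAut K)) := by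
  obtain ⟨V, hV⟩ := (𝓝 (1 : K)).exists_antitone_basis
  obtain ⟨W, hW⟩ := (𝓝 x).exists_antitone_basis
  have key (n : ℕ) : ∃ γ ∈ Λ, ∃ v ∈ V n, (γ : MulAut K) v ∈ W n := by
    set O : Set K := ⋃ γ ∈ Λ, ⇑(γ : MulAut K) '' interior (V n)
    have hOopen : IsOpen O := by
      refine isOpen_biUnion fun γ _ => ?_
      have : ⇑(γ : MulAut K) '' interior (V n) = ⇑(γ : MulAut K).symm ⁻¹' interior (V n) :=
        (γ : MulAut K).toEquiv.image_eq_preimage_symm _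
      rw [this]
      exact isOpen_interior.preimage (ContAut.continuous_symm γ)
    have hone : (1 : K) ∈ O := by
      refine mem_biUnion Λ.one_mem ⟨1, ?_, by simp⟩
      exact mem_interior_iff_mem_nhds.2 (hV.mem n)
    have hmaps : ∀ α ∈ Λ, ∀ y ∈ O, (α : MulAut K) y ∈ O := by
      intro α hα y hy
      obtain ⟨γ, hγ, v, hv, rfl⟩ := mem_iUnion₂.1 hy
      exact mem_biUnion (Λ.mul_mem hα hγ) ⟨v, hv, rfl⟩
    have hinv : ∀ α ∈ (Λ : Set ↥(ContAut K)), (α : MulAut K) '' O = O := by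
      intro α hα
      refine Subset.antisymm (image_subset_iff.2 (hmaps α hα)) fun y hy => ?_
      exact ⟨_, hmaps _ (Λ.inv_mem hα) y hy, (α : MulAut K).apply_symm_apply y⟩
    have hμO : μ Oᶜ = 0 := by
      rcases h O hOopen.measurableSet hinv with h0 | h1
      · exact absurd h0 (hOopen.measure_ne_zero μ ⟨1, hone⟩)
      · exact (prob_compl_eq_zero_iff hOopen.measurableSet).2 h1
    have hne : ¬ W n ⊆ Oᶜ := fun hsub =>
      (Measure.measure_pos_of_mem_nhds μ (hW.mem n)).ne' (measure_mono_null hsub hμO)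
    obtain ⟨y, hyW, hyO⟩ := not_subset.1 hne
    obtain ⟨γ, hγ, v, hv, rfl⟩ := mem_iUnion₂.1 (not_not.1 hyO)
    exact ⟨γ, hγ, v, interior_subset hv, hyW⟩
  choose γ hγ v hv hw using key
  exact ⟨γ, v, hγ, hV.tendsto hv, hW.tendsto hw⟩

variable [IsTopologicalGroup K] [CompactSpace K]

lemma measurePreserving_contAut (α : ↥(ContAut K)) : MeasurePreserving ⇑(α : MulAut K) μ μ := by
  have := secondCountableTopology_of_compact_metrizable K
  exact MonoidHom.measurePreserving (f := (α : MulAut K).toMonoidHom) (ContAut.continuous α)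
    (α : MulAut K).surjective rfl

variable [IsProbabilityMeasure μ]

/-- The prolongation of `1` stabilises every invariant set up to null sets. -/
lemma prolongation_subset_aestabilizer {S : Set ↥(ContAut K)} {A : Set K}
    (hA : MeasurableSet A) (hinv : ∀ α ∈ S, (α : MulAut K) '' A = A) {x : K}
    (hx : x ∈ prolongation S) : (x * ·) ⁻¹' A =ᵐ[μ] A := by
  have := secondCountableTopology_of_compact_metrizable K
  let f : C(K, C(K, K)) := ContinuousMap.curry ⟨fun p : K × K => p.1 * p.2, continuous_mul⟩
  have hf (g : K) : MeasurePreserving (f g) μ μ := measurePreserving_mul_left μ g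
  have hcont {u : ℕ → K} {y : K} (hu : Tendsto u atTop (𝓝 y)) :
      Tendsto (fun n => μ ((f (u n) ⁻¹' A) ∆ (f y ⁻¹' A))) atTop (𝓝 0) :=
    tendsto_measure_symmDiff_preimage_nhds_zero ((f.continuous.tendsto y).comp hu)
      (Eventually.of_forall fun n => hf _) (hf y) hA.nullMeasurableSet (measure_ne_top μ A)
  obtain ⟨γ, v, hγ, hv, hx⟩ := hx
  have hone : f 1 ⁻¹' A = A := by
    ext y
    simp [f]
  have hmem (n : ℕ) (y : K) : (γ n : MulAut K) y ∈ A ↔ y ∈ A := by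
    conv_lhs => rw [← hinv _ (hγ n)]
    exact (γ n : MulAut K).injective.mem_set_image
  have heq (n : ℕ) : μ ((f ((γ n : MulAut K) (v n)) ⁻¹' A) ∆ A) = μ ((f (v n) ⁻¹' A) ∆ A) := by
    rw [← (measurePreserving_contAut μ (γ n)).measure_preimage
      (((f _).continuous.measurable hA).symmDiff hA).nullMeasurableSet]
    congr 1
    ext y
    have h := hmem n (v n * y)
    rw [map_mul] at h
    simp [f, mem_symmDiff, hmem, h]
  have h1 := hcont hv
  rw [hone] at h1
  have h2 := (hcont hx).add h1
  rw [add_zero] at h2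
  have hle (n : ℕ) : μ ((f x ⁻¹' A) ∆ A) ≤
      μ ((f ((γ n : MulAut K) (v n)) ⁻¹' A) ∆ (f x ⁻¹' A)) + μ ((f (v n) ⁻¹' A) ∆ A) := by
    rw [← heq, symmDiff_comm (f ((γ n : MulAut K) (v n)) ⁻¹' A) (f x ⁻¹' A)]
    exact measure_symmDiff_le _ _ _
  exact measure_symmDiff_eq_zero_iff.1
    (le_antisymm (ge_of_tendsto' h2 hle) zero_le)

lemma ergSet_of_ergCore_eq_top {S : Set ↥(ContAut K)} (h : ergCore S = ⊤) : ErgSet μ S := by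
  have := secondCountableTopology_of_compact_metrizable K
  intro A hA hinv
  have hdense : Dense (MulAction.aestabilizer K μ A : Set K) := by
    have hle : Subgroup.closure (prolongation S) ≤ MulAction.aestabilizer K μ A := by
      refine (Subgroup.closure_le _).2 fun x hx => ?_
      have := prolongation_subset_aestabilizer μ hA hinv hx
      rw [SetLike.mem_coe, ← inv_mem_iff, MulAction.mem_aestabilizer, ← preimage_smul]
      exact this
    refine Dense.mono hle ?_
    rw [dense_iff_closure_eq, ← Subgroup.topologicalClosure_coe]
    exact congrArg _ h
  have hconst := aeconst_of_dense_aestabilizer_smul hA.nullMeasurableSet hdense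
  rcases eventuallyConst_set.1 hconst with h1 | h0
  · right
    rw [← prob_compl_eq_zero_iff hA]
    exact h1
  · left
    exact measure_eq_zero_iff_ae_notMem.2 h0

end Measure

end Prolongation

section Generators

lemma zpow_decomposition {G : Type*} [CommGroup G] (a b c : G) (i m q r y : ℤ) :
    a ^ (r + m * q + i * y) * b ^ y * c =
      a ^ r * ((a ^ i * b) ^ (y - q) * c * (a ^ (i + m) * b) ^ q) := by
  have key {M : Type _} [AddCommGroup M] (a b c : M) :
      (r + m * q + i * y) • a + y • b + c =
        r • a + ((y - q) • (i • a + b) + c + q • ((i + m) • a + b)) := by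
    module
  exact key (M := Additive G) a b c

variable [Group K] [TopologicalSpace K] [IsTopologicalGroup K]
  [CompactSpace K] [TopologicalSpace.MetrizableSpace K]

/-- Equicontinuity modulo `H` passes from the two subgroups `⟨a ^ i * b, R⟩` and
`⟨a ^ j * b, R⟩`, `i < j`, to `⟨a, b, R⟩`. -/
lemma prolongation_subset_of_two_twists {G : Type*} [CommGroup G] (φ : G →* ↥(ContAut K))
    (a b : G) (R : Subgroup G) {H : Subgroup K} (hH : IsClosed (H : Set K))
    (hmaps : MapsInto (Set.range φ) H) {i j : ℕ} (hij : i < j)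
    (hi : prolongation ((Subgroup.zpowers (a ^ i * b) ⊔ R).map φ : Set ↥(ContAut K)) ⊆ H)
    (hj : prolongation ((Subgroup.zpowers (a ^ j * b) ⊔ R).map φ : Set ↥(ContAut K)) ⊆ H) :
    prolongation ((Subgroup.zpowers a ⊔ (Subgroup.zpowers b ⊔ R)).map φ :
      Set ↥(ContAut K)) ⊆ H := by
  set Λ : ℕ → Subgroup ↥(ContAut K) := fun i => (Subgroup.zpowers (a ^ i * b) ⊔ R).map φ
  have hΛ (i : ℕ) : MapsInto (Λ i : Set ↥(ContAut K)) H := by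
    rintro _ ⟨g, -, rfl⟩ x hx
    exact hmaps _ ⟨g, rfl⟩ x hx
  have hprod : prolongation {γ | ∃ s ∈ Λ i, ∃ t ∈ Λ j, γ = s * t} ⊆ H :=
    prolongation_subset_of_mul hH (hΛ i) hi hj fun γ hγ => hγ
  let F : Set ↥(ContAut K) := (fun r : ℤ => φ (a ^ r)) '' Set.Ico 0 ((j : ℤ) - i)
  have hF : F.Finite := (Set.finite_Ico _ _).image _
  refine prolongation_subset_of_mul (S := F) hH ?_ (prolongation_subset_of_finite hF H) hprod ?_
  · rintro _ ⟨r, -, rfl⟩ x hx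
    exact hmaps _ ⟨_, rfl⟩ x hx
  · rintro _ ⟨g, hg, rfl⟩
    obtain ⟨_, ⟨x, rfl⟩, _, hbR, rfl⟩ := Subgroup.mem_sup.1 hg
    obtain ⟨_, ⟨y, rfl⟩, c, hc, rfl⟩ := Subgroup.mem_sup.1 hbR
    have hm : (0 : ℤ) < (j : ℤ) - i := by omega
    set m : ℤ := (j : ℤ) - i
    set q : ℤ := (x - i * y) / m
    set r : ℤ := (x - i * y) % m
    have hx : x = r + m * q + i * y := by
      have := Int.emod_add_mul_ediv (x - i * y) m
      linarith
    have hjm : (i : ℤ) + m = j := by ring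
    refine ⟨φ (a ^ r), ⟨r, ⟨Int.emod_nonneg _ hm.ne', Int.emod_lt_of_pos _ hm⟩, rfl⟩,
      φ ((a ^ i * b) ^ (y - q) * c * (a ^ j * b) ^ q),
      ⟨φ ((a ^ i * b) ^ (y - q) * c), ⟨_, Subgroup.mul_mem_sup ⟨_, rfl⟩ hc, rfl⟩,
        φ ((a ^ j * b) ^ q), ⟨_, Subgroup.mem_sup_left ⟨_, rfl⟩, rfl⟩, map_mul _ _ _⟩, ?_⟩
    rw [← map_mul]
    congr 1
    have h := zpow_decomposition a b c i m q r y
    rw [← hx, hjm, zpow_natCast, zpow_natCast] at h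
    rw [← h]
    exact (mul_assoc _ _ _).symm

variable [MeasurableSpace K] [BorelSpace K] (μ : Measure K) [μ.IsHaarMeasure]
  [IsProbabilityMeasure μ]

/-- Under the descending chain condition, two generators `a`, `b` of an ergodic abelian group
can be replaced by a single `a ^ i * b`. -/
lemma exists_twist_ergodic {G : Type*} [CommGroup G] (φ : G →* ↥(ContAut K))
    (hdcc : HasDCC {β : ↥(ContAut K) | ∀ g, β * φ g = φ g * β})
    (a b : G) (R : Subgroup G)
    (herg : ErgSet μ ((Subgroup.zpowers a ⊔ (Subgroup.zpowers b ⊔ R)).map φ :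
      Set ↥(ContAut K))) :
    ∃ i : ℕ, 0 < i ∧
      ErgSet μ ((Subgroup.zpowers (a ^ i * b) ⊔ R).map φ : Set ↥(ContAut K)) := by
  set Λ : ℕ → Subgroup ↥(ContAut K) :=
    fun i => (Subgroup.zpowers (a ^ (i + 1) * b) ⊔ R).map φ
  set N : ℕ → Subgroup K := fun i => ergCore (Λ i : Set ↥(ContAut K))
  set D : ℕ → Subgroup K := fun k => ⨅ i : Fin k, N i
  have hNcl (i : ℕ) : IsClosed (N i : Set K) := isClosed_ergCore _
  have hDcl (k : ℕ) : IsClosed (D k : Set K) := by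
    simp only [D, Subgroup.coe_iInf]
    exact isClosed_iInter fun i => hNcl i
  have hDle {i k : ℕ} (h : i < k) : D k ≤ N i := iInf_le (fun i : Fin k => N i) ⟨i, h⟩
  have hDsucc (k : ℕ) : D k ⊓ N k ≤ D (k + 1) := by
    refine le_iInf fun i => ?_
    rcases Nat.lt_succ_iff_lt_or_eq.1 i.2 with h | h
    · exact inf_le_left.trans (hDle h)
    · rw [h]
      exact inf_le_right
  have hNmaps {β : ↥(ContAut K)} (hβ : ∀ g, β * φ g = φ g * β) (i : ℕ) {x : K}
      (hx : x ∈ N i) : (β : MulAut K) x ∈ N i := by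
    refine mem_ergCore_of_commute ?_ hx
    rintro _ ⟨g, -, rfl⟩
    exact hβ g
  have hDmaps {β : ↥(ContAut K)} (hβ : ∀ g, β * φ g = φ g * β) (k : ℕ) {x : K}
      (hx : x ∈ D k) : (β : MulAut K) x ∈ D k :=
    Subgroup.mem_iInf.2 fun i => hNmaps hβ i (Subgroup.mem_iInf.1 hx i)
  have hφ (g h : G) : φ g * φ h = φ h * φ g := by
    rw [← map_mul, mul_comm, map_mul]
  obtain ⟨k, hk⟩ := hdcc D hDcl (fun k => le_iInf fun i => hDle (by omega)) (by
    intro k β hβ x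
    refine ⟨hDmaps hβ k, fun hx => ?_⟩
    have hβ' : ∀ g, β⁻¹ * φ g = φ g * β⁻¹ := fun g =>
      ((show Commute β (φ g) from hβ g).inv_left).eq
    have := hDmaps hβ' k hx
    simpa using this)
  have hkA : D k ≤ N k := by
    rw [← hk (k + 1) (Nat.le_succ k)]
    exact hDle (Nat.lt_succ_self k)
  have : (N k).Normal := normal_ergCore _
  have hmem {t : ℕ} {x : K} : x ∈ D t ⊔ N k ↔ ∃ d ∈ D t, ∃ c ∈ N k, d * c = x :=
    Subgroup.mem_sup_of_normal_right
  have hsupcl (t : ℕ) : IsClosed ((D t ⊔ N k : Subgroup K) : Set K) := by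
    rw [Subgroup.mul_normal]
    exact ((hDcl t).isCompact.mul (hNcl k).isCompact).isClosed
  have hΛmaps {H : Subgroup K} (hH : MapsInto (Set.range φ) H) (i : ℕ) :
      MapsInto (Λ i : Set ↥(ContAut K)) H := by
    rintro _ ⟨g, -, rfl⟩ x hx
    exact hH _ ⟨g, rfl⟩ x hx
  have hDinv (t : ℕ) : MapsInto (Set.range φ) (D t) := by
    rintro _ ⟨g, rfl⟩ x hx
    exact hDmaps (hφ g) t hx
  have hNinv (i : ℕ) : MapsInto (Set.range φ) (N i) := by
    rintro _ ⟨g, rfl⟩ x hx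
    exact hNmaps (hφ g) i hx
  have hsupinv (t : ℕ) : MapsInto (Set.range φ) (D t ⊔ N k) := by
    intro γ hγ x hx
    obtain ⟨d, hd, c, hc, rfl⟩ := hmem.1 hx
    rw [map_mul]
    exact Subgroup.mul_mem_sup (hDinv t γ hγ d hd) (hNinv k γ hγ c hc)
  have htop (t : ℕ) : t ≤ k → D t ⊔ N k = ⊤ := by
    induction t with
    | zero => simp [D]
    | succ t ih =>
      intro ht
      have hprev := ih (by omega)
      have hpt : prolongation (Λ t : Set ↥(ContAut K)) ⊆ (D (t + 1) ⊔ N k : Subgroup K) := by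
        refine (prolongation_subset_inf_sup (hDcl t) (hNcl k) (hΛmaps (hDinv t) t)
          (hΛmaps (hNinv k) t) (fun x => hmem.1 (hprev ▸ Subgroup.mem_top x))
          (prolongation_subset_ergCore _)).trans ?_
        exact sup_le_sup_right (hDsucc t) _
      have hpk : prolongation (Λ k : Set ↥(ContAut K)) ⊆ (D (t + 1) ⊔ N k : Subgroup K) :=
        (prolongation_subset_ergCore _).trans (le_sup_right : N k ≤ D (t + 1) ⊔ N k)
      have hall := prolongation_subset_of_two_twists φ a b R (hsupcl (t + 1)) (hsupinv (t + 1))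
        (show t + 1 < k + 1 by omega) hpt hpk
      exact (Subgroup.eq_top_iff' _).2 fun x => hall (mem_prolongation_of_ergSet μ herg x)
  refine ⟨k + 1, k.succ_pos, ergSet_of_ergCore_eq_top μ ?_⟩
  have := htop k le_rfl
  rwa [sup_eq_right.2 hkA] at this

lemma exists_pow_mul_prod_ergodic {G : Type*} [CommGroup G] (φ : G →* ↥(ContAut K))
    (hdcc : HasDCC {β : ↥(ContAut K) | ∀ g, β * φ g = φ g * β}) {n : ℕ} (a : G) (b : Fin n → G)
    (herg : ErgSet μ ((Subgroup.zpowers a ⊔ Subgroup.closure (Set.range b)).map φ :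
      Set ↥(ContAut K))) :
    ∃ (k : ℕ) (m : Fin n → ℕ), 0 < k ∧ (∀ i, 0 < m i) ∧
      ErgAut μ (φ (a ^ k * (List.ofFn fun i => b i ^ m i).prod)) := by
  induction n generalizing a with
  | zero =>
    refine ⟨1, Fin.elim0, one_pos, fun i => i.elim0, ?_⟩
    have h : Set.range (fun n : ℤ => φ a ^ n) =
        ((Subgroup.zpowers a ⊔ Subgroup.closure (Set.range b)).map φ : Set ↥(ContAut K)) := by
      rw [Set.range_eq_empty b, Subgroup.closure_empty, sup_bot_eq, MonoidHom.map_zpowers,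
        Subgroup.coe_zpowers]
    simpa [ErgAut, h] using herg
  | succ n ih =>
    have hsup : Subgroup.closure (Set.range b) =
        Subgroup.zpowers (b 0) ⊔ Subgroup.closure (Set.range (Fin.tail b)) := by
      rw [Subgroup.zpowers_eq_closure, ← Subgroup.closure_union, ← Set.insert_eq,
        ← Fin.range_cons, Fin.cons_self_tail]
    rw [hsup] at herg
    obtain ⟨i, hi, hierg⟩ := exists_twist_ergodic μ φ hdcc a (b 0) _ herg
    obtain ⟨k, m, hk, hm, hkm⟩ := ih _ _ hierg
    refine ⟨i * k, Fin.cons k m, Nat.mul_pos hi hk, ?_, ?_⟩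
    · intro l
      refine Fin.cases ?_ ?_ l
      · simpa using hk
      · intro l
        simpa using hm l
    · rw [mul_pow, ← pow_mul, mul_assoc] at hkm
      simpa [List.ofFn_succ, Fin.tail] using hkm

end Generators

/-- Theorem 4.1, Berend's theorem for ergodic `ℤ^d`-actions. Let `Γ` be
a finitely generated abelian group of continuous automorphisms of a compact metrizable
group `K`, generated by `α 1, …, α n`. If `Γ` is ergodic on `K` and the centre `Z(Γ)` of
the action has DCC on `K`, then some element of `Γ` is ergodic on `K`; moreover there are
positive integers `m 1, …, m n` such that `α 1 ^ m 1 * ⋯ * α n ^ m n` is ergodic on `K`. -/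
theorem statement10 {K : Type*} [Group K] [TopologicalSpace K] [IsTopologicalGroup K]
    [CompactSpace K] [TopologicalSpace.MetrizableSpace K]
    [MeasurableSpace K] [BorelSpace K]
    (μ : Measure K) [μ.IsHaarMeasure] [IsProbabilityMeasure μ]
    {n : ℕ} (α : Fin n → ↥(ContAut K))
    (hcomm : ∀ i j, α i * α j = α j * α i)
    (Γ : Subgroup ↥(ContAut K)) (hΓ : Γ = Subgroup.closure (Set.range α))
    (herg : ErgSet μ (Γ : Set ↥(ContAut K)))
    (hdcc : HasDCC {β : ↥(ContAut K) | ∀ γ ∈ Γ, β * γ = γ * β}) :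
    (∃ a ∈ Γ, ErgAut μ a) ∧
    ∃ m : Fin n → ℕ, (∀ i, 0 < m i) ∧ ErgAut μ (List.ofFn fun i => α i ^ m i).prod := by
  subst hΓ
  have : IsMulCommutative ↥(Subgroup.closure (Set.range α)) :=
    Subgroup.isMulCommutative_closure (by
      rintro _ ⟨i, rfl⟩ _ ⟨j, rfl⟩
      exact hcomm i j)
  let _ : CommGroup ↥(Subgroup.closure (Set.range α)) :=
    { (inferInstance : Group ↥(Subgroup.closure (Set.range α))) with mul_comm := mul_comm' }
  let b : Fin n → ↥(Subgroup.closure (Set.range α)) :=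
    fun i => ⟨α i, Subgroup.subset_closure ⟨i, rfl⟩⟩
  let φ := (Subgroup.closure (Set.range α)).subtype
  have hφ (g : ↥(Subgroup.closure (Set.range α))) : φ g ∈ Subgroup.closure (Set.range α) := g.2
  have hmap : (Subgroup.zpowers 1 ⊔ Subgroup.closure (Set.range b)).map φ =
      Subgroup.closure (Set.range α) := by
    rw [Subgroup.zpowers_one_eq_bot, bot_sup_eq, MonoidHom.map_closure, ← Set.range_comp]
    rfl
  obtain ⟨k, m, -, hm, hkm⟩ := exists_pow_mul_prod_ergodic μ φ
    (by simpa [φ] using hdcc) 1 b (by rwa [hmap])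
  have hprod : φ (1 ^ k * (List.ofFn fun i => b i ^ m i).prod) =
      (List.ofFn fun i => α i ^ m i).prod := by
    rw [one_pow, one_mul, map_list_prod, List.map_ofFn]
    rfl
  rw [hprod] at hkm
  exact ⟨⟨_, hprod ▸ hφ _, hkm⟩, m, hm, hkm⟩

end ErgZd
end

section
/- Let K be a compact metrizable group and let α, β be two commuting continuous automorphisms of K. Suppose α is ergodic on K and β is distal on K. Then α^i β^j is ergodic on K for all integers i and j with i ≠ 0. -/
open MeasureTheory Topology Set

set_option linter.unusedVariables false

namespace ErgZd

variable {K : Type*}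

section Proof

open scoped symmDiff

lemma ContAut.coe_zpow_add_apply [Group K] [TopologicalSpace K] (α : ↥(ContAut K))
    (m n : ℤ) (x : K) :
    ((α ^ (m + n) : ↥(ContAut K)) : MulAut K) x =
      ((α ^ m : ↥(ContAut K)) : MulAut K) (((α ^ n : ↥(ContAut K)) : MulAut K) x) := by
  rw [zpow_add]; rfl

/-- The enveloping (Ellis) semigroup of an automorphism: the pointwise closure of its powers. -/
def ellis [Group K] [TopologicalSpace K] (β : ↥(ContAut K)) : Set (K → K) :=
  closure (range fun n : ℤ => ⇑((β ^ n : ↥(ContAut K)) : MulAut K))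

section Ellis

variable [Group K] [TopologicalSpace K] {β : ↥(ContAut K)} {f g : K → K}

lemma comp_mem_ellis (hf : f ∈ ellis β) (hg : g ∈ ellis β) : f ∘ g ∈ ellis β := by
  have hpow : ∀ n : ℤ, ∀ h ∈ ellis β, ⇑((β ^ n : ↥(ContAut K)) : MulAut K) ∘ h ∈ ellis β := by
    intro n h hh
    refine map_mem_closure (f := fun h : K → K => ⇑((β ^ n : ↥(ContAut K)) : MulAut K) ∘ h)
      ?_ hh ?_
    · exact continuous_pi fun x => (ContAut.continuous (β ^ n)).comp (continuous_apply x)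
    · rintro _ ⟨m, rfl⟩
      exact ⟨n + m, funext fun x => ContAut.coe_zpow_add_apply β n m x⟩
  have hcomp : Continuous fun h : K → K => h ∘ g :=
    continuous_pi fun x => continuous_apply (g x)
  have hmem : f ∘ g ∈ closure (ellis β) := by
    refine map_mem_closure (f := fun h : K → K => h ∘ g) hcomp hf ?_
    rintro _ ⟨n, rfl⟩
    exact hpow n g hg
  rwa [ellis, closure_closure] at hmem

lemma apply_mem_of_mem_ellis (hf : f ∈ ellis β) {N : Set K} (hN : IsClosed N)
    (hβ : ∀ n : ℤ, ∀ x ∈ N, ((β ^ n : ↥(ContAut K)) : MulAut K) x ∈ N) {x : K} (hx : x ∈ N) :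
    f x ∈ N := by
  have hmem : f x ∈ closure N := by
    refine map_mem_closure (f := fun h : K → K => h x) (continuous_apply x) hf ?_
    rintro _ ⟨n, rfl⟩
    exact hβ n x hx
  rwa [hN.closure_eq] at hmem

lemma apply_mem_closure_orbit_s11 (hf : f ∈ ellis β) (x : K) :
    f x ∈ closure (range fun n : ℤ => ((β ^ n : ↥(ContAut K)) : MulAut K) x) := by
  refine map_mem_closure (f := fun h : K → K => h x) (continuous_apply x) hf ?_
  rintro _ ⟨n, rfl⟩
  exact ⟨n, rfl⟩

lemma map_inv_mul_of_mem_ellis [IsTopologicalGroup K] [T2Space K] (hf : f ∈ ellis β) (x y : K) :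
    f (x⁻¹ * y) = (f x)⁻¹ * f y := by
  have hclosed : IsClosed {h : K → K | h (x⁻¹ * y) = (h x)⁻¹ * h y} :=
    isClosed_eq (continuous_apply _) ((continuous_apply x).inv.mul (continuous_apply y))
  refine closure_minimal ?_ hclosed hf
  rintro _ ⟨n, rfl⟩
  simp

lemma DistalAut.notMem_closure_orbit (hβ : DistalAut β) {x : K} (hx : x ≠ 1) :
    (1 : K) ∉ closure (range fun n : ℤ => ((β ^ n : ↥(ContAut K)) : MulAut K) x) := by
  have h := hβ x hx
  rwa [← range_comp] at h

lemma DistalAut.zpow (hβ : DistalAut β) (j : ℤ) : DistalAut (β ^ j) := by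
  intro x hx h
  refine hβ x hx (closure_mono ?_ h)
  rintro _ ⟨_, ⟨n, rfl⟩, rfl⟩
  exact ⟨_, ⟨j * n, rfl⟩, by simp only [zpow_mul]⟩

/-- Every element of the enveloping semigroup of a distal automorphism has a left inverse in it. -/
lemma DistalAut.exists_comp_eq_id [IsTopologicalGroup K] [CompactSpace K] [T2Space K]
    (hβ : DistalAut β) (hf : f ∈ ellis β) : ∃ g ∈ ellis β, g ∘ f = id := by
  let _ : TopologicalSpace (Function.End K) := Pi.topologicalSpace
  have _ : T2Space (Function.End K) := inferInstanceAs (T2Space (K → K))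
  have hcont : ∀ r : K → K, Continuous fun h : K → K => h ∘ r := fun r =>
    continuous_pi fun x => continuous_apply (r x)
  obtain ⟨_, ⟨g, hg, rfl⟩, hidem⟩ := exists_idempotent_in_compact_subsemigroup
    (M := Function.End K) hcont ((fun h : K → K => h ∘ f) '' ellis β)
    ⟨_, f, hf, rfl⟩ ((isClosed_closure.isCompact).image (hcont f)) (by
      rintro _ ⟨g, hg, rfl⟩ _ ⟨h, hh, rfl⟩
      exact ⟨g ∘ f ∘ h, comp_mem_ellis hg (comp_mem_ellis hf hh), rfl⟩)
  refine ⟨g, hg, funext fun x => ?_⟩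
  have hgf := comp_mem_ellis hg hf
  have hfix : (g ∘ f) ((g ∘ f) x) = (g ∘ f) x := congrFun hidem x
  by_contra hne
  refine hβ.notMem_closure_orbit (x := x⁻¹ * (g ∘ f) x) (fun h => hne ?_) ?_
  · exact (inv_mul_eq_one.mp h).symm
  · have hmem := apply_mem_closure_orbit_s11 hgf (x⁻¹ * (g ∘ f) x)
    rwa [map_inv_mul_of_mem_ellis hgf, hfix, inv_mul_cancel] at hmem

end Ellis

lemma ErgAut.exists_dense_orbit [Group K] [TopologicalSpace K]
    [SecondCountableTopology K] [MeasurableSpace K] [BorelSpace K] {μ : Measure K}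
    [μ.IsOpenPosMeasure] [IsProbabilityMeasure μ] {α : ↥(ContAut K)} (hα : ErgAut μ α) :
    ∃ x : K, Dense (range fun n : ℤ => ((α ^ n : ↥(ContAut K)) : MulAut K) x) := by
  let B := TopologicalSpace.countableBasis K
  let S : Set K → Set K := fun U => ⋃ n : ℤ, ⇑((α ^ n : ↥(ContAut K)) : MulAut K) ⁻¹' U
  have hS : ∀ U ∈ B, ∀ᵐ x ∂μ, x ∈ S U := by
    intro U hU
    have hUo := TopologicalSpace.isOpen_of_mem_countableBasis hU
    have hSo : IsOpen (S U) := isOpen_iUnion fun n => hUo.preimage (ContAut.continuous (α ^ n))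
    have hsub : ∀ m : ℤ, ∀ x ∈ S U, ((α ^ m : ↥(ContAut K)) : MulAut K) x ∈ S U := by
      intro m x hx
      obtain ⟨n, hn⟩ := mem_iUnion.mp hx
      refine mem_iUnion.mpr ⟨n - m, ?_⟩
      rw [mem_preimage, ← ContAut.coe_zpow_add_apply, sub_add_cancel]
      exact hn
    have hinv : ∀ γ ∈ range (fun n : ℤ => α ^ n), (γ : MulAut K) '' S U = S U := by
      rintro _ ⟨m, rfl⟩
      refine subset_antisymm (image_subset_iff.mpr (hsub m)) fun x hx => ?_
      refine ⟨_, hsub (-m) x hx, ?_⟩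
      rw [← ContAut.coe_zpow_add_apply, add_neg_cancel, zpow_zero]
      rfl
    rcases hα (S U) hSo.measurableSet hinv with h | h
    · have hne : (S U).Nonempty := by
        obtain ⟨x, hx⟩ := TopologicalSpace.nonempty_of_mem_countableBasis hU
        exact ⟨x, mem_iUnion.mpr ⟨0, by simpa using hx⟩⟩
      exact absurd h (hSo.measure_ne_zero μ hne)
    · exact (prob_compl_eq_zero_iff hSo.measurableSet).mpr h
  obtain ⟨x, hx⟩ := ((ae_ball_iff (TopologicalSpace.countable_countableBasis K)).mpr hS).exists
  refine ⟨x, (TopologicalSpace.isBasis_countableBasis K).dense_iff.mpr fun U hU _ => ?_⟩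
  obtain ⟨n, hn⟩ := mem_iUnion.mp (hx U hU)
  exact ⟨_, hn, n, rfl⟩

/-- The measure of the difference between a set and its translates. -/
noncomputable def translateDefect [Group K] [MeasurableSpace K] (μ : Measure K) (A : Set K)
    (x : K) : ENNReal :=
  μ (((x • ·) ⁻¹' A) ∆ A)

lemma translateDefect_one [Group K] [MeasurableSpace K] {μ : Measure K} (A : Set K) :
    translateDefect μ A 1 = 0 := by
  simp [translateDefect]

section Haar

variable [Group K] [TopologicalSpace K] [IsTopologicalGroup K] [CompactSpace K]
  [MeasurableSpace K] [BorelSpace K] {μ : Measure K}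

lemma ContAut.measurePreserving [μ.IsHaarMeasure] (α : ↥(ContAut K)) :
    MeasurePreserving ⇑(α : MulAut K) μ μ :=
  MonoidHom.measurePreserving (f := (α : MulAut K).toMonoidHom) (ContAut.continuous α)
    (α : MulAut K).surjective rfl

lemma continuous_translateDefect [T2Space K] [SecondCountableTopology K]
    [μ.IsHaarMeasure] {A : Set K}
    (hA : MeasurableSet A) : Continuous (translateDefect μ A) := by
  let f : C(K × K, K) := ⟨fun p => p.1 * p.2, continuous_mul⟩
  have hf : ∀ z, MeasurePreserving (f.curry z) μ μ := fun z => measurePreserving_mul_left μ z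
  let F : K → MeasuredSets μ := fun x => ⟨f.curry x ⁻¹' A, (hf x).measurable hA⟩
  have hF : Continuous F := by
    refine continuous_iff_continuousAt.mpr fun x => tendsto_iff_edist_tendsto_0.mpr ?_
    exact tendsto_measure_symmDiff_preimage_nhds_zero (f.curry.continuous.tendsto x)
      (.of_forall hf) (hf x) hA.nullMeasurableSet (measure_ne_top μ A)
  let A₀ : MeasuredSets μ := ⟨A, hA⟩
  exact hF.edist (continuous_const (y := A₀))

lemma translateDefect_apply [μ.IsHaarMeasure] {A : Set K} (hA : MeasurableSet A)
    {γ : ↥(ContAut K)} (hγ : (γ : MulAut K) '' A = A) (x : K) :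
    translateDefect μ A ((γ : MulAut K) x) = translateDefect μ A x := by
  have hpre : ⇑(γ : MulAut K) ⁻¹' A = A := by
    conv_lhs => rw [← hγ]
    exact preimage_image_eq _ (γ : MulAut K).injective
  have hmeas : ∀ z : K, MeasurableSet ((fun y : K => z * y) ⁻¹' A) := fun z =>
    (continuous_const_mul z).measurable hA
  unfold translateDefect
  simp only [smul_eq_mul]
  rw [← (ContAut.measurePreserving (μ := μ) γ).measure_preimage
    ((hmeas _).symmDiff hA).nullMeasurableSet, preimage_symmDiff, hpre]
  congr 2
  conv_rhs => rw [← hpre]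
  ext y
  simp

end Haar

end Proof

/-- Lemma 4.2. Let `α, β` be commuting continuous automorphisms of a
compact metrizable group `K` with `α` ergodic and `β` distal. Then `α ^ i * β ^ j` is
ergodic on `K` for all integers `i ≠ 0` and all integers `j`. -/
theorem statement11 {K : Type*} [Group K] [TopologicalSpace K] [IsTopologicalGroup K]
    [CompactSpace K] [TopologicalSpace.MetrizableSpace K]
    [MeasurableSpace K] [BorelSpace K]
    (μ : Measure K) [μ.IsHaarMeasure] [IsProbabilityMeasure μ]
    (α β : ↥(ContAut K)) (hcomm : α * β = β * α)
    (hα : ErgAut μ α) (hβ : DistalAut β) :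
    ∀ i j : ℤ, i ≠ 0 → ErgAut μ (α ^ i * β ^ j) := by
  intro i j hi A hA hinv
  set a := α ^ i with ha
  set b := β ^ j with hb
  have hab : Commute α b := (show Commute α β from hcomm).zpow_right j
  have haa : Commute α a := (Commute.refl α).zpow_right i
  have hρ := continuous_translateDefect (μ := μ) hA
  -- powers of `b` and of `a⁻¹` differ by powers of `a * b`, which preserve `A`
  have hswap : ∀ (m n : ℤ) (x : K),
      translateDefect μ A (((α ^ m : ↥(ContAut K)) : MulAut K)
        (((b ^ n : ↥(ContAut K)) : MulAut K) x)) =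
      translateDefect μ A (((α ^ m : ↥(ContAut K)) : MulAut K)
        (((a ^ (-n) : ↥(ContAut K)) : MulAut K) x)) := by
    intro m n x
    have heq : α ^ m * b ^ n = (a * b) ^ n * (α ^ m * a ^ (-n)) := by
      have h1 : Commute a b := hab.zpow_left i
      have h2 : Commute (α ^ m) (b ^ n) := hab.zpow_zpow m n
      have h3 : Commute (α ^ m) (a ^ (-n)) := haa.zpow_zpow m (-n)
      rw [h1.mul_zpow, (h1.zpow_zpow n n).eq, h3.eq, mul_assoc, zpow_neg, mul_inv_cancel_left,
        h2.eq]
    exact (congrArg (fun γ : ↥(ContAut K) => translateDefect μ A ((γ : MulAut K) x)) heq).trans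
      (translateDefect_apply hA (hinv _ ⟨n, rfl⟩) _)
  obtain ⟨x, hx⟩ := hα.exists_dense_orbit
  -- some point `y` of the orbit of `x` has `1` in the closure of its orbit under `a`
  obtain ⟨r, hr⟩ : ∃ r : ℤ, (1 : K) ∈ closure (range fun n : ℤ =>
      ((a ^ (-n) : ↥(ContAut K)) : MulAut K) (((α ^ r : ↥(ContAut K)) : MulAut K) x)) := by
    have hcover : (range fun n : ℤ => ((α ^ n : ↥(ContAut K)) : MulAut K) x) ⊆
        ⋃ r ∈ Finset.Ico 0 |i|, range fun n : ℤ =>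
          ((a ^ (-n) : ↥(ContAut K)) : MulAut K) (((α ^ r : ↥(ContAut K)) : MulAut K) x) := by
      rintro _ ⟨n, rfl⟩
      refine mem_iUnion₂.mpr ⟨n % i, Finset.mem_Ico.mpr
        ⟨Int.emod_nonneg n hi, Int.emod_lt_abs n hi⟩, -(n / i), ?_⟩
      dsimp only
      rw [neg_neg, ha, ← zpow_mul, ← ContAut.coe_zpow_add_apply, Int.mul_ediv_add_emod]
    have h1 := closure_mono hcover (hx 1)
    rw [Finset.closure_biUnion] at h1
    obtain ⟨r, _, hr⟩ := mem_iUnion₂.mp h1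
    exact ⟨r, hr⟩
  set y := ((α ^ r : ↥(ContAut K)) : MulAut K) x with hy
  let N : Set K := {z | ∀ m : ℤ, translateDefect μ A (((α ^ m : ↥(ContAut K)) : MulAut K) z) = 0}
  have hN : IsClosed N := by
    simp only [N, ofPred_forall]
    exact isClosed_iInter fun m =>
      isClosed_eq (hρ.comp (ContAut.continuous (α ^ m))) continuous_const
  have hbN : ∀ n : ℤ, ∀ z ∈ N, ((b ^ n : ↥(ContAut K)) : MulAut K) z ∈ N := by
    intro n z hz m
    rw [hswap, ha, ← zpow_mul, ← ContAut.coe_zpow_add_apply]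
    exact hz _
  -- a limit `p` of powers of `b` along which the inverse powers of `a` bring `y` to `1`
  obtain ⟨p, hp, hpy⟩ : ∃ p ∈ ellis b, p y ∈ N := by
    let u : ℤ → K := fun n => ((a ^ (-n) : ↥(ContAut K)) : MulAut K) y
    have hne : (Filter.comap u (𝓝 1)).NeBot := by
      rw [Filter.comap_neBot_iff_frequently]
      exact mem_closure_iff_frequently.mp hr
    let U := Ultrafilter.of (Filter.comap u (𝓝 1))
    have hU : Filter.Tendsto u U (𝓝 1) :=
      Filter.tendsto_comap.mono_left (Ultrafilter.of_le _)
    let v : ℤ → K → K := fun n => ⇑((b ^ n : ↥(ContAut K)) : MulAut K)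
    obtain ⟨p, -, hp⟩ := isCompact_univ.ultrafilter_le_nhds (U.map v) (by simp)
    have hp : Filter.Tendsto v U (𝓝 p) := hp
    refine ⟨p, mem_closure_of_tendsto hp (.of_forall fun n => ⟨n, rfl⟩), fun m => ?_⟩
    have hm := hρ.comp (ContAut.continuous (α ^ m))
    have h1 := (hm.tendsto (p y)).comp ((continuous_apply y).continuousAt.tendsto.comp hp)
    have h2 := (hm.tendsto 1).comp hU
    refine (tendsto_nhds_unique h1 (h2.congr fun n => (hswap m n y).symm)).trans ?_
    simp [translateDefect_one]
  obtain ⟨q, hq, hqp⟩ := (hβ.zpow j).exists_comp_eq_id hp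
  have hyN : y ∈ N := by
    rw [← show q (p y) = y from congrFun hqp y]
    exact apply_mem_of_mem_ellis hq hN hbN hpy
  have hdense : Dense {g : K | (g • ·) ⁻¹' A =ᵐ[μ] A} := by
    refine hx.mono ?_
    rintro _ ⟨n, rfl⟩
    refine measure_symmDiff_eq_zero_iff.mp ?_
    have h := hyN (n - r)
    rwa [hy, ← ContAut.coe_zpow_add_apply, sub_add_cancel] at h
  have hconst := aeconst_of_dense_setOfPred_preimage_smul_ae hA.nullMeasurableSet hdense
  rcases Filter.eventuallyConst_set'.mp hconst with h | h
  · exact .inl (by simpa using measure_congr h)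
  · exact .inr (by simpa using measure_congr h)

end ErgZd
end
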